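/- arXiv:2507.11880 — 2 statements merged into one kernel-verified Lean document; each statement's English description precedes it below -/
import Mathlib

section
/- Let X_free ⊆ ℝ², let σ be a path in X_free of finite cost ending at x₀ = σ(1), let l be the straight-line path from x₀ to x₁ with segment [x₀,x₁] ⊆ X_free, and define f(t) := m[σ * l_{[0,t]}] for t ∈ [0,1]. Then f is continuous on [0,1]. -/
noncomputable section

/-- Points of the plane. -/
abbrev E2 : Type := EuclideanSpace ℝ (Fin 2)

namespace THPP

lemma subIcc_mem (s t₁ t₂ : unitInterval) :
    (1 - s.1) * t₁.1 + s.1 * t₂.1 ∈ Set.Icc (0 : ℝ) 1 := by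
  have hs0 : (0:ℝ) ≤ s.1 := s.2.1
  have hs1 : s.1 ≤ 1 := s.2.2
  have ha0 : (0:ℝ) ≤ t₁.1 := t₁.2.1
  have ha1 : t₁.1 ≤ 1 := t₁.2.2
  have hb0 : (0:ℝ) ≤ t₂.1 := t₂.2.1
  have hb1 : t₂.1 ≤ 1 := t₂.2.2
  constructor
  · have h1 := mul_nonneg (by linarith : (0:ℝ) ≤ 1 - s.1) ha0
    have h2 := mul_nonneg hs0 hb0
    linarith
  · have h1 := mul_nonneg (by linarith : (0:ℝ) ≤ 1 - s.1) (by linarith : (0:ℝ) ≤ 1 - t₁.1)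
    have h2 := mul_nonneg hs0 (by linarith : (0:ℝ) ≤ 1 - t₂.1)
    nlinarith

/-- The subpath `σ_{[t₁,t₂]} : s ↦ σ ((1-s)·t₁ + s·t₂)`. -/
def subpath {Y : Type*} [TopologicalSpace Y] {a b : Y} (σ : Path a b) (t₁ t₂ : unitInterval) :
    Path (σ t₁) (σ t₂) where
  toFun s := σ ⟨(1 - s.1) * t₁.1 + s.1 * t₂.1, subIcc_mem s t₁ t₂⟩
  continuous_toFun := σ.continuous.comp (Continuous.subtype_mk (by fun_prop) _)
  source' := by
    exact congrArg (fun u => σ u) (Subtype.ext (by simp))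
  target' := by
    exact congrArg (fun u => σ u) (Subtype.ext (by simp))

/-- The subpath `σ_{[0,t]}`, as a path from the start point of `σ` to `σ t`. -/
def subpath0 {Y : Type*} [TopologicalSpace Y] {a b : Y} (σ : Path a b) (t : unitInterval) :
    Path a (σ t) :=
  (subpath σ 0 t).cast σ.source.symm rfl

/-- The straight-line path `t ↦ (1-t)·x₀ + t·x₁`, as a path in `X` given that the
segment `[x₀, x₁]` is contained in `X`. -/
def linePath {X : Set E2} {x₀ x₁ : E2} (h₀ : x₀ ∈ X) (h₁ : x₁ ∈ X)
    (hseg : segment ℝ x₀ x₁ ⊆ X) : Path (⟨x₀, h₀⟩ : X) ⟨x₁, h₁⟩ where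
  toFun t := ⟨(1 - t.1) • x₀ + t.1 • x₁,
    hseg (by rw [segment_eq_image]; exact ⟨t.1, t.2, rfl⟩)⟩
  continuous_toFun := Continuous.subtype_mk (by fun_prop) _
  source' := Subtype.ext (by simp)
  target' := Subtype.ext (by simp)

/-- The cost (arc length) of a path in a subset of the plane: the total variation of the
underlying map `[0,1] → ℝ²`. -/
def cost {X : Set E2} {a b : X} (σ : Path a b) : ENNReal :=
  eVariationOn (fun t => (σ t : E2)) Set.univ

/-- A path is an optimal homotopic path if it has minimal cost within its
path-homotopy class (homotopies staying in `X`). -/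
def IsOptimal {X : Set E2} {a b : X} (σ : Path a b) : Prop :=
  ∀ σ' : Path a b, σ.Homotopic σ' → cost σ ≤ cost σ'

/-- `m[σ]`: the infimal cost of the path-homotopy class of `σ`. -/
def mCost {X : Set E2} {a b : X} (σ : Path a b) : ENNReal :=
  ⨅ σ' : {σ' : Path a b // σ.Homotopic σ'}, cost σ'.1

/-- Concatenation `σ₀ * σ₁ * ⋯ * σ_{n-1}` of a chain of paths. -/
def chain {Y : Type*} [TopologicalSpace Y] (x : ℕ → Y)
    (σ : ∀ i : ℕ, Path (x i) (x (i + 1))) : ∀ n : ℕ, Path (x 0) (x n)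
  | 0 => Path.refl (x 0)
  | n + 1 => (chain x σ n).trans (σ n)


lemma cost_trans_le {X : Set E2} {a b c : X} (p : Path a b) (q : Path b c) :
    cost (p.trans q) ≤ cost p + cost q := by
  let h : unitInterval := ⟨1 / 2, by norm_num, by norm_num⟩
  have hU : (Set.univ : Set unitInterval) = Set.Iic h ∪ Set.Ici h := by
    ext t; simp
  unfold cost
  rw [hU, eVariationOn.union (x := h) _ isGreatest_Iic isLeast_Ici, ← hU]
  refine add_le_add ?_ ?_
  · have e : Set.EqOn (fun t => ((p.trans q) t : E2))
        ((fun t => (p t : E2)) ∘ fun t : unitInterval =>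
          Set.projIcc (0 : ℝ) 1 zero_le_one (2 * t.1)) (Set.Iic h) := by
      intro t ht
      have ht' : (t : ℝ) ≤ 1 / 2 := ht
      have := Path.extend_trans_of_le_half p q ht'
      rw [Path.extend_apply _ t.2] at this
      exact congrArg Subtype.val this
    rw [eVariationOn.eq_of_eqOn e]
    refine eVariationOn.comp_le_of_monotoneOn _ _ ?_ (fun _ _ => Set.mem_univ _)
    intro x _ y _ hxy
    have : (x : ℝ) ≤ y := hxy
    exact Set.monotone_projIcc _ (by linarith)
  · have e : Set.EqOn (fun t => ((p.trans q) t : E2))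
        ((fun t => (q t : E2)) ∘ fun t : unitInterval =>
          Set.projIcc (0 : ℝ) 1 zero_le_one (2 * t.1 - 1)) (Set.Ici h) := by
      intro t ht
      have ht' : 1 / 2 ≤ (t : ℝ) := ht
      have := Path.extend_trans_of_half_le p q ht'
      rw [Path.extend_apply _ t.2] at this
      exact congrArg Subtype.val this
    rw [eVariationOn.eq_of_eqOn e]
    refine eVariationOn.comp_le_of_monotoneOn _ _ ?_ (fun _ _ => Set.mem_univ _)
    intro x _ y _ hxy
    have : (x : ℝ) ≤ y := hxy
    exact Set.monotone_projIcc _ (by linarith)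

lemma subpath_eq {Y : Type*} [TopologicalSpace Y] {a b : Y} (σ : Path a b)
    (s t : unitInterval) : subpath σ s t = σ.subpath s t := by
  ext u
  exact congrArg σ (Subtype.ext (by simp [Set.Icc.convexComb]))

lemma subpath_trans_homotopic {Y : Type*} [TopologicalSpace Y] {a b : Y} (σ : Path a b)
    (s t : unitInterval) :
    ((subpath0 σ s).trans (subpath σ s t)).Homotopic (subpath0 σ t) := by
  have h : ((σ.subpath 0 s).trans (σ.subpath s t)).Homotopic (σ.subpath 0 t) :=
    ⟨Path.Homotopy.subpathTransSubpath σ 0 s t⟩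
  have := h.pathCast σ.source.symm rfl
  rw [← subpath_eq, ← subpath_eq, ← subpath_eq] at this
  exact this

lemma eVar_val : eVariationOn (fun t : unitInterval => (t : ℝ)) Set.univ ≤ 1 := by
  have h : MonotoneOn (fun t : unitInterval => (t : ℝ)) Set.univ := fun _ _ _ _ h => h
  have := (h.eVariationOn_eq (Set.mem_univ (0 : unitInterval)) (Set.mem_univ 1)).le
  have e : Set.univ ∩ Set.Icc (0 : unitInterval) 1 = Set.univ := by
    ext t; simp [unitInterval.le_one']
  rw [e] at this
  simpa using this

lemma cost_line_le {X : Set E2} {x₀ x₁ : E2} (h₀ : x₀ ∈ X) (h₁ : x₁ ∈ X)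
    (hseg : segment ℝ x₀ x₁ ⊆ X) (s t : unitInterval) :
    cost (subpath (linePath h₀ h₁ hseg) s t) ≤ ((nndist x₀ x₁ * nndist t s : NNReal) : ENNReal) := by
  let g : ℝ → E2 := fun u => (1 - ((1 - u) * s.1 + u * t.1)) • x₀ + ((1 - u) * s.1 + u * t.1) • x₁
  have hg : LipschitzWith (nndist x₀ x₁ * nndist t s) g := by
    refine LipschitzWith.of_dist_le_mul fun u v => ?_
    have : g u - g v = ((u - v) * (t.1 - s.1)) • (x₁ - x₀) := by
      simp only [g]; module
    rw [dist_eq_norm, this, norm_smul, norm_mul]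
    push_cast
    rw [Subtype.dist_eq, Real.dist_eq, Real.dist_eq, dist_comm x₀, dist_eq_norm, Real.norm_eq_abs,
      Real.norm_eq_abs]
    apply le_of_eq; ring
  have := (hg.lipschitzOnWith (s := Set.univ)).comp_eVariationOn_le
    (g := fun t : unitInterval => (t : ℝ)) (s := Set.univ) (fun _ _ => Set.mem_univ _)
  refine this.trans ?_
  calc _ ≤ _ := mul_le_mul_right eVar_val _
    _ = _ := mul_one _

lemma mCost_step {X : Set E2} {xa : X} {x₀ x₁ : E2}
    (h₀ : x₀ ∈ X) (h₁ : x₁ ∈ X) (hseg : segment ℝ x₀ x₁ ⊆ X)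
    (σ : Path xa (⟨x₀, h₀⟩ : X)) (s t : unitInterval) :
    mCost (σ.trans (subpath0 (linePath h₀ h₁ hseg) t)) ≤
      mCost (σ.trans (subpath0 (linePath h₀ h₁ hseg) s)) +
        ((nndist x₀ x₁ * nndist t s : NNReal) : ENNReal) := by
  conv_rhs => rw [mCost]
  rw [ENNReal.iInf_add]
  refine le_iInf fun τ => ?_
  have hom : (σ.trans (subpath0 (linePath h₀ h₁ hseg) t)).Homotopic
      (τ.1.trans (subpath (linePath h₀ h₁ hseg) s t)) := by
    refine Path.Homotopic.trans ?_ (τ.2.hcomp (Path.Homotopic.refl _))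
    refine Path.Homotopic.trans ?_ (Path.Homotopic.symm ⟨Path.Homotopy.transAssoc _ _ _⟩)
    exact (Path.Homotopic.refl _).hcomp (subpath_trans_homotopic _ s t).symm
  refine (iInf_le _ ⟨_, hom⟩).trans ?_
  exact (cost_trans_le _ _).trans (add_le_add le_rfl (cost_line_le h₀ h₁ hseg s t))

lemma cost_subpath0 {X : Set E2} {a b : X} (l : Path a b) (t : unitInterval) :
    cost (subpath0 l t) = cost (subpath l 0 t) := rfl

lemma mCost_fin {X : Set E2} {xa : X} {x₀ x₁ : E2}
    (h₀ : x₀ ∈ X) (h₁ : x₁ ∈ X) (hseg : segment ℝ x₀ x₁ ⊆ X)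
    (σ : Path xa (⟨x₀, h₀⟩ : X)) (hfin : cost σ ≠ ⊤) (t : unitInterval) :
    mCost (σ.trans (subpath0 (linePath h₀ h₁ hseg) t)) ≠ ⊤ := by
  have h1 : mCost (σ.trans (subpath0 (linePath h₀ h₁ hseg) t)) ≤
      cost (σ.trans (subpath0 (linePath h₀ h₁ hseg) t)) :=
    iInf_le (fun σ' : {σ' // (σ.trans (subpath0 (linePath h₀ h₁ hseg) t)).Homotopic σ'} =>
      cost σ'.1) ⟨_, Path.Homotopic.refl _⟩
  refine ne_top_of_le_ne_top ?_ (h1.trans (cost_trans_le _ _))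
  refine ENNReal.add_ne_top.2 ⟨hfin, ?_⟩
  rw [cost_subpath0]
  have h := cost_line_le h₀ h₁ hseg 0 t
  exact (lt_of_le_of_lt h ENNReal.coe_lt_top).ne

/-- the function `f(t) = m[σ * l_{[0,t]}]` (real-valued, `σ` of finite
cost) is continuous on `[0,1]`. -/
theorem mcost_line_continuous {X : Set E2} {xa : X} {x₀ x₁ : E2}
    (h₀ : x₀ ∈ X) (h₁ : x₁ ∈ X) (hseg : segment ℝ x₀ x₁ ⊆ X)
    (σ : Path xa (⟨x₀, h₀⟩ : X)) (hfin : cost σ ≠ ⊤)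
    (f : unitInterval → ℝ)
    (hf : ∀ t, f t = (mCost (σ.trans (subpath0 (linePath h₀ h₁ hseg) t))).toReal) :
    Continuous f := by
  refine (LipschitzWith.of_le_add_mul (nndist x₀ x₁) fun t s => ?_).continuous
  have h := mCost_step h₀ h₁ hseg σ s t
  have hs := mCost_fin h₀ h₁ hseg σ hfin s
  have := ENNReal.toReal_mono (ENNReal.add_ne_top.2 ⟨hs, ENNReal.coe_ne_top⟩) h
  rw [ENNReal.toReal_add hs ENNReal.coe_ne_top, ← hf, ← hf] at this
  rw [ENNReal.coe_toReal, NNReal.coe_mul, coe_nndist t s] at this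
  exact this

end THPP
end
end

section
/- Let X_free be a compact, path-connected subset of ℝ² equal to a finite union of convex polygons. Let σ be a path in X_free of finite cost ending at x₀ = σ(1), let l be the straight-line path from x₀ to x₁ with segment [x₀,x₁] ⊆ X_free, and define f(t) := m[σ * l_{[0,t]}] for t ∈ [0,1]. Then f is a convex function on [0,1]. -/
noncomputable section

namespace THPP

def ConeLike (S : Set E2) (R : ℝ) : Prop :=
  (0:E2) ∈ S ∧ ∀ x ∈ S, ‖x‖ < R → ∀ k : ℝ, 0 ≤ k → ‖k • x‖ < R → k • x ∈ S

def Vis (S : Set E2) (x y : E2) : Prop :=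
  ∀ t : ℝ, 0 ≤ t → t ≤ 1 → (1 - t) • x + t • y ∈ S

open Classical in
def dC (S : Set E2) (x y : E2) : ℝ := if Vis S x y then ‖x - y‖ else ‖x‖ + ‖y‖

lemma Vis.symm {S : Set E2} {x y : E2} (h : Vis S x y) : Vis S y x := by
  intro t h0 h1
  have := h (1 - t) (by linarith) (by linarith)
  rw [add_comm]; simpa using this

lemma vis_comm {S : Set E2} {x y : E2} : Vis S x y ↔ Vis S y x := ⟨Vis.symm, Vis.symm⟩

lemma dC_symm (S : Set E2) (x y : E2) : dC S x y = dC S y x := by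
  unfold dC
  rw [vis_comm (x := x) (y := y), norm_sub_rev x y, add_comm ‖x‖ ‖y‖]

lemma dC_vis {S : Set E2} {x y : E2} (h : Vis S x y) : dC S x y = ‖x - y‖ := if_pos h
lemma dC_nvis {S : Set E2} {x y : E2} (h : ¬ Vis S x y) : dC S x y = ‖x‖ + ‖y‖ := if_neg h
lemma dC_le (S : Set E2) (x y : E2) : dC S x y ≤ ‖x‖ + ‖y‖ := by
  unfold dC; split_ifs
  · exact norm_sub_le _ _
  · exact le_rfl
lemma dC_ge (S : Set E2) (x y : E2) : ‖x - y‖ ≤ dC S x y := by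
  unfold dC; split_ifs
  · exact le_rfl
  · exact norm_sub_le _ _
lemma dC_nonneg (S : Set E2) (x y : E2) : 0 ≤ dC S x y := (norm_nonneg _).trans (dC_ge S x y)

lemma norm_comb_lt {x y : E2} {R t : ℝ} (hx : ‖x‖ < R) (hy : ‖y‖ < R) (h0 : 0 ≤ t) (h1 : t ≤ 1) :
    ‖(1 - t) • x + t • y‖ < R := by
  have h := (convex_ball (0:E2) R) (x := x) (by simpa using hx) (y := y) (by simpa using hy)
    (a := 1 - t) (b := t) (by linarith) h0 (by ring)
  simpa using h

lemma vis_sub {S : Set E2} {x y : E2} (h : Vis S x y) {s : ℝ} (h0 : 0 ≤ s) (h1 : s ≤ 1) :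
    Vis S x ((1 - s) • x + s • y) := by
  intro t t0 t1
  have := h (t * s) (by positivity) (by nlinarith)
  convert this using 1
  module

/-- Two-dimensional cross product. -/
def cr (x y : E2) : ℝ := x 0 * y 1 - x 1 * y 0

lemma cr_decomp (x y z : E2) (h : cr x y ≠ 0) :
    z = (cr z y / cr x y) • x + (cr x z / cr x y) • y := by
  ext i
  have k0 : cr x y * z 0 = cr z y * x 0 + cr x z * y 0 := by unfold cr; ring
  have k1 : cr x y * z 1 = cr z y * x 1 + cr x z * y 1 := by unfold cr; ring
  fin_cases i
  · simp only [Fin.zero_eta, PiLp.add_apply, PiLp.smul_apply, smul_eq_mul]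
    field_simp; linarith
  · simp only [Fin.mk_one, PiLp.add_apply, PiLp.smul_apply, smul_eq_mul]
    field_simp; linarith

lemma vis_zero {S : Set E2} {R : ℝ} (hS : ConeLike S R) {x : E2} (hx : x ∈ S) (hR : ‖x‖ < R) :
    Vis S 0 x := by
  intro t t0 t1
  have h := norm_comb_lt (x := 0) (y := x) (R := R) (t := t) (by simpa using (norm_nonneg x).trans_lt hR) hR t0 t1
  simp only [smul_zero, zero_add] at h ⊢
  exact hS.2 x hx hR t t0 h

lemma vis_smul {S : Set E2} {R : ℝ} (hS : ConeLike S R) {x : E2} (hx : x ∈ S) (hR : ‖x‖ < R)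
    {k : ℝ} (hy : k • x ∈ S) (hyR : ‖k • x‖ < R) : Vis S x (k • x) := by
  intro t t0 t1
  have hn := norm_comb_lt hR hyR t0 t1
  have e : (1 - t) • x + t • k • x = (1 - t + t * k) • x := by module
  rw [e] at hn ⊢
  by_cases hc : 0 ≤ 1 - t + t * k
  · exact hS.2 x hx hR _ hc hn
  · push Not at hc
    have hk : k < 0 := by
      by_contra hk
      push Not at hk
      nlinarith [mul_nonneg t0 hk]
    have e2 : (1 - t + t * k) • x = ((1 - t + t * k) / k) • (k • x) := by
      rw [smul_smul, div_mul_cancel₀ _ hk.ne]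
    rw [e2] at hn ⊢
    exact hS.2 _ hy hyR _ (div_nonneg_of_nonpos hc.le hk.le) hn

lemma vis_of_cr {S : Set E2} {R : ℝ} (hS : ConeLike S R) {x y : E2} (hx : x ∈ S) (hR : ‖x‖ < R)
    (hy : y ∈ S) (hyR : ‖y‖ < R) (h : cr x y = 0) : Vis S x y := by
  by_cases hx0 : x = 0
  · subst hx0; exact vis_zero hS hy hyR
  · have : ∃ k : ℝ, y = k • x := by
      have h' : x 0 * y 1 - x 1 * y 0 = 0 := h
      by_cases h0 : x 0 = 0
      · have h1 : x 1 ≠ 0 := by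
          intro h1; apply hx0; ext i; fin_cases i <;> simp [h0, h1]
        refine ⟨y 1 / x 1, ?_⟩
        have : y 0 = 0 := by
          have : x 1 * y 0 = 0 := by rw [h0] at h'; linarith
          rcases mul_eq_zero.1 this with h | h
          · exact absurd h h1
          · exact h
        ext i; fin_cases i
        · simp [h0, this]
        · simp; field_simp
      · refine ⟨y 0 / x 0, ?_⟩
        ext i; fin_cases i
        · simp; field_simp
        · simp; field_simp; linarith
    obtain ⟨k, rfl⟩ := this
    exact vis_smul hS hx hR hy hyR

lemma nvis_exists {S : Set E2} {x y : E2} (hx : x ∈ S) (hy : y ∈ S) (h : ¬ Vis S x y) :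
    ∃ t : ℝ, 0 < t ∧ t < 1 ∧ (1 - t) • x + t • y ∉ S := by
  unfold Vis at h
  push Not at h
  obtain ⟨t, t0, t1, ht⟩ := h
  refine ⟨t, lt_of_le_of_ne t0 ?_, lt_of_le_of_ne t1 ?_, ht⟩
  · rintro rfl; apply ht; simpa using hx
  · rintro rfl; apply ht; simpa using hy

/-- the key lemma: if `x,y` do not see each other but `z` sees both, then `0` is in the triangle. -/
lemma key {S : Set E2} {R : ℝ} (hS : ConeLike S R) {x y z : E2} (hx : x ∈ S) (hxR : ‖x‖ < R)
    (hy : y ∈ S) (hyR : ‖y‖ < R) (hzR : ‖z‖ < R) (hxy : ¬ Vis S x y) (hxz : Vis S x z)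
    (hyz : Vis S y z) : ∃ α β : ℝ, 0 ≤ α ∧ 0 ≤ β ∧ z = -(α • x + β • y) := by
  have hcr : cr x y ≠ 0 := fun h => hxy (vis_of_cr hS hx hxR hy hyR h)
  obtain ⟨t, t0, t1, ht⟩ := nvis_exists hx hy hxy
  obtain ⟨α, β, hz⟩ : ∃ α β : ℝ, z = α • x + β • y := ⟨_, _, cr_decomp x y z hcr⟩
  have hmR := norm_comb_lt hxR hyR t0.le t1.le
  have hmiss : ∀ k : ℝ, 0 < k → ‖k • ((1 - t) • x + t • y)‖ < R → k • ((1 - t) • x + t • y) ∉ S := by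
    intro k hk hn hmem
    apply ht
    have := hS.2 _ hmem hn k⁻¹ (by positivity)
    rw [smul_smul, inv_mul_cancel₀ hk.ne', one_smul] at this
    exact this hmR
  suffices h : α ≤ 0 ∧ β ≤ 0 by
    refine ⟨-α, -β, by linarith [h.1], by linarith [h.2], ?_⟩
    rw [hz]; module
  rcases le_total 0 (β * (1 - t) - α * t) with hD | hD
  · have hβ : β ≤ 0 := by
      by_contra hβ
      push Not at hβ
      set D := β * (1 - t) - α * t with hDdef
      have hpos : 0 < t + D := by linarith
      have h1 := hxz (t / (t + D)) (by positivity) (by rw [div_le_one hpos]; linarith)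
      have h2 := norm_comb_lt hxR hzR (t := t / (t + D)) (by positivity) (by rw [div_le_one hpos]; linarith)
      have e : (1 - t / (t + D)) • x + (t / (t + D)) • z = (β / (t + D)) • ((1 - t) • x + t • y) := by
        rw [hz]
        have e1 : (1 - t / (t + D)) + (t / (t + D)) * α = (β / (t + D)) * (1 - t) := by
          field_simp; rw [hDdef]; ring
        have e2 : (t / (t + D)) * β = (β / (t + D)) * t := by ring
        calc _ = ((1 - t / (t + D)) + (t / (t + D)) * α) • x + ((t / (t + D)) * β) • y := by module
          _ = _ := by rw [e1, e2]; module
      rw [e] at h1 h2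
      exact hmiss _ (by positivity) h2 h1
    refine ⟨?_, hβ⟩
    by_contra hα
    push Not at hα
    nlinarith [mul_pos hα t0, mul_nonneg (neg_nonneg.2 hβ) (by linarith : (0:ℝ) ≤ 1 - t)]
  · have hα : α ≤ 0 := by
      by_contra hα
      push Not at hα
      set D := α * t - β * (1 - t) with hDdef
      have hD' : 0 ≤ D := by rw [hDdef]; linarith
      have ht' : 0 < 1 - t := by linarith
      have hpos : 0 < (1 - t) + D := by linarith
      have h1 := hyz ((1 - t) / ((1 - t) + D)) (by positivity) (by rw [div_le_one hpos]; linarith)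
      have h2 := norm_comb_lt hyR hzR (t := (1 - t) / ((1 - t) + D)) (by positivity) (by rw [div_le_one hpos]; linarith)
      have e : (1 - (1 - t) / ((1 - t) + D)) • y + ((1 - t) / ((1 - t) + D)) • z
          = (α / ((1 - t) + D)) • ((1 - t) • x + t • y) := by
        rw [hz]
        have e1 : (1 - (1 - t) / ((1 - t) + D)) + ((1 - t) / ((1 - t) + D)) * β = (α / ((1 - t) + D)) * t := by
          field_simp; rw [hDdef]; ring
        have e2 : ((1 - t) / ((1 - t) + D)) * α = (α / ((1 - t) + D)) * (1 - t) := by ring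
        calc _ = ((1 - (1 - t) / ((1 - t) + D)) + ((1 - t) / ((1 - t) + D)) * β) • y
                + (((1 - t) / ((1 - t) + D)) * α) • x := by module
          _ = _ := by rw [e1, e2]; module
      rw [e] at h1 h2
      exact hmiss _ (by positivity) h2 h1
    refine ⟨hα, ?_⟩
    by_contra hβ
    push Not at hβ
    nlinarith [mul_pos hβ (by linarith : (0:ℝ) < 1 - t), mul_nonneg (neg_nonneg.2 hα) t0.le]

lemma norm_triangle_in {x y z : E2} {α β : ℝ} (hα : 0 ≤ α) (hβ : 0 ≤ β)
    (hz : z = -(α • x + β • y)) : ‖x‖ + ‖y‖ ≤ ‖x - z‖ + ‖y - z‖ := by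
  by_cases hx0 : x = 0
  · subst hx0
    have := norm_sub_le (y - z) (0 - z)
    simp only [sub_sub_sub_cancel_right, sub_zero] at this
    simpa [add_comm] using this
  by_cases hy0 : y = 0
  · subst hy0
    have := norm_sub_le (x - z) (0 - z)
    simp only [sub_sub_sub_cancel_right, sub_zero] at this
    simpa [add_comm] using this
  have hx : 0 < ‖x‖ := norm_pos_iff.2 hx0
  have hy : 0 < ‖y‖ := norm_pos_iff.2 hy0
  have h1 : ‖x‖ * ‖x - z‖ ≥ inner ℝ x (x - z) := real_inner_le_norm _ _
  have h2 : ‖y‖ * ‖y - z‖ ≥ inner ℝ y (y - z) := real_inner_le_norm _ _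
  have h3 := neg_le_of_abs_le (abs_real_inner_le_norm x y)
  have e1 : inner ℝ x (x - z) = ‖x‖ ^ 2 + α * ‖x‖ ^ 2 + β * inner ℝ x y := by
    rw [hz]
    simp only [inner_sub_right, inner_neg_right, inner_add_right, inner_smul_right,
      real_inner_self_eq_norm_sq]; ring
  have e2 : inner ℝ y (y - z) = ‖y‖ ^ 2 + α * inner ℝ x y + β * ‖y‖ ^ 2 := by
    rw [hz]
    simp only [inner_sub_right, inner_neg_right, inner_add_right, inner_smul_right,
      real_inner_self_eq_norm_sq, real_inner_comm x y]; ring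
  rw [e1] at h1; rw [e2] at h2
  have h1' : ‖x - z‖ ≥ ‖x‖ + α * ‖x‖ - β * ‖y‖ := by
    have : ‖x‖ * ‖x - z‖ ≥ ‖x‖ * (‖x‖ + α * ‖x‖ - β * ‖y‖) := by nlinarith
    exact le_of_mul_le_mul_left this hx
  -- refined
  have h4 : ‖x‖ * ‖y‖ * (‖x - z‖ + ‖y - z‖) ≥ ‖x‖ * ‖y‖ * (‖x‖ + ‖y‖) := by
    have a1 : ‖y‖ * (‖x‖ * ‖x - z‖) ≥ ‖y‖ * (‖x‖ ^ 2 + α * ‖x‖ ^ 2 + β * inner ℝ x y) :=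
      mul_le_mul_of_nonneg_left h1 hy.le
    have a2 : ‖x‖ * (‖y‖ * ‖y - z‖) ≥ ‖x‖ * (‖y‖ ^ 2 + α * inner ℝ x y + β * ‖y‖ ^ 2) :=
      mul_le_mul_of_nonneg_left h2 hx.le
    have a3 : 0 ≤ (α * ‖x‖ + β * ‖y‖) * (inner ℝ x y + ‖x‖ * ‖y‖) := by
      apply mul_nonneg <;> [positivity; linarith]
    nlinarith
  exact le_of_mul_le_mul_left h4 (by positivity)

lemma fill {S : Set E2} {R : ℝ} (hS : ConeLike S R) {a b x : E2} (haR : ‖a‖ < R)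
    (hbR : ‖b‖ < R) (hxR : ‖x‖ < R) (hab : Vis S a b) (hxa : Vis S x a) (hxb : Vis S x b)
    {s : ℝ} (h0 : 0 ≤ s) (h1 : s ≤ 1) : Vis S x ((1 - s) • a + s • b) := by
  by_contra hn
  set g := (1 - s) • a + s • b with hg
  have hx : x ∈ S := by simpa using hxa 0 le_rfl zero_le_one
  have hgS : g ∈ S := hab s h0 h1
  have hgR : ‖g‖ < R := norm_comb_lt haR hbR h0 h1
  have hag : Vis S a g := vis_sub hab h0 h1
  have hbg : Vis S b g := by
    have := vis_sub hab.symm (s := 1 - s) (by linarith) (by linarith)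
    rw [hg, add_comm]; simpa using this
  obtain ⟨α, β, hα, hβ, ha⟩ := key hS hx hxR hgS hgR haR hn hxa hag.symm
  obtain ⟨α', β', hα', hβ', hb⟩ := key hS hx hxR hgS hgR hbR hn hxb hbg.symm
  apply hn
  have e : (1 + (1 - s) * β + s * β') • g = (-((1 - s) * α + s * α')) • x := by
    have : g = (1 - s) • (-(α • x + β • g)) + s • (-(α' • x + β' • g)) := by rw [← ha, ← hb]
    calc _ = g + ((1 - s) * β + s * β') • g := by module
      _ = ((1 - s) • (-(α • x + β • g)) + s • (-(α' • x + β' • g))) + ((1 - s) * β + s * β') • g := by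
        rw [← this]
      _ = _ := by module
  have hs' : 0 ≤ 1 - s := by linarith
  have hpos : 0 < 1 + (1 - s) * β + s * β' := by positivity
  have e' : g = ((1 + (1 - s) * β + s * β')⁻¹ * (-((1 - s) * α + s * α'))) • x := by
    rw [mul_smul, ← e, smul_smul, inv_mul_cancel₀ hpos.ne', one_smul]
  rw [e'] at hgS hgR ⊢
  exact vis_smul hS hx hxR hgS hgR

lemma sq_comb (a b x : E2) (s : ℝ) : ‖x - ((1 - s) • a + s • b)‖ ^ 2 =
    (1 - s) * ‖x - a‖ ^ 2 + s * ‖x - b‖ ^ 2 - s * (1 - s) * ‖a - b‖ ^ 2 := by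
  simp only [EuclideanSpace.norm_sq_eq, Fin.sum_univ_two, PiLp.sub_apply, PiLp.add_apply,
    PiLp.smul_apply, Real.norm_eq_abs, sq_abs, smul_eq_mul]
  ring

lemma sq_sub (x y : E2) : ‖x - y‖ ^ 2 = ‖x‖ ^ 2 - 2 * inner ℝ x y + ‖y‖ ^ 2 := norm_sub_sq_real x y

/-- The half of the visible case. -/
lemma cnA3 {S : Set E2} {R : ℝ} (hS : ConeLike S R) {a b x : E2} (haR : ‖a‖ < R)
    (hbR : ‖b‖ < R) (hxR : ‖x‖ < R) (hab : Vis S a b) (hxa : Vis S x a) (hxb : ¬ Vis S x b)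
    {s : ℝ} (h0 : 0 ≤ s) (h1 : s ≤ 1) :
    dC S x ((1 - s) • a + s • b) ^ 2 ≤
      (1 - s) * dC S x a ^ 2 + s * dC S x b ^ 2 - s * (1 - s) * dC S a b ^ 2 := by
  set g := (1 - s) • a + s • b with hg
  have hx : x ∈ S := by simpa using hxa 0 le_rfl zero_le_one
  have hgS : g ∈ S := hab s h0 h1
  have hgR : ‖g‖ < R := norm_comb_lt haR hbR h0 h1
  have hag : Vis S a g := vis_sub hab h0 h1
  rw [dC_vis hxa, dC_nvis hxb, dC_vis hab]
  have hid := sq_comb a b x s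
  rw [← hg] at hid
  have hxbsq := sq_sub x b
  have hcs := neg_le_of_abs_le (abs_real_inner_le_norm x b)
  by_cases hxg : Vis S x g
  · rw [dC_vis hxg, hid]
    nlinarith [mul_nonneg h0 (by linarith : 0 ≤ inner ℝ x b + ‖x‖ * ‖b‖)]
  · rw [dC_nvis hxg]
    obtain ⟨α, β, hα, hβ, ha⟩ := key hS hx hxR hgS hgR haR hxg hxa hag.symm
    have hxgsq := sq_sub x g
    have hk : 0 ≤ 1 - s := by linarith
    have hsb : s • b = (1 + (1 - s) * β) • g - (-((1 - s) * α)) • x := by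
      have : s • b = g - (1 - s) • a := by rw [hg]; module
      rw [this]
      calc g - (1 - s) • a = g - (1 - s) • (-(α • x + β • g)) := by rw [← ha]
        _ = _ := by module
    have hnb : (1 + (1 - s) * β) * ‖g‖ - ((1 - s) * α) * ‖x‖ ≤ s * ‖b‖ := by
      have h := norm_sub_norm_le ((1 + (1 - s) * β) • g) ((-((1 - s) * α)) • x)
      rw [← hsb, norm_smul, norm_smul, norm_smul, Real.norm_of_nonneg h0, norm_neg,
        Real.norm_of_nonneg (by positivity), Real.norm_of_nonneg (by positivity)] at h
      exact h
    have hcs2 := neg_le_of_abs_le (abs_real_inner_le_norm x g)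
    have hxa' : inner ℝ x a = -(α * ‖x‖ ^ 2 + β * inner ℝ x g) := by
      nth_rewrite 1 [ha]
      simp only [inner_neg_right, inner_add_right, inner_smul_right, real_inner_self_eq_norm_sq]
    have hxg' : inner ℝ x g = (1 - s) * inner ℝ x a + s * inner ℝ x b := by
      rw [hg]; simp only [inner_add_right, inner_smul_right]
    have goal1 : ‖x‖ * ‖g‖ + (1 - s) * inner ℝ x a ≤ s * (‖x‖ * ‖b‖) := by
      have h := mul_le_mul_of_nonneg_left hnb (norm_nonneg x)
      have h2 : 0 ≤ (1 - s) * β * (inner ℝ x g + ‖x‖ * ‖g‖) := by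
        apply mul_nonneg (by positivity); linarith
      rw [hxa']
      nlinarith
    nlinarith

lemma cnA {S : Set E2} {R : ℝ} (hS : ConeLike S R) {a b x : E2} (haR : ‖a‖ < R)
    (hbR : ‖b‖ < R) (hxR : ‖x‖ < R) (hab : Vis S a b)
    {s : ℝ} (h0 : 0 ≤ s) (h1 : s ≤ 1) :
    dC S x ((1 - s) • a + s • b) ^ 2 ≤
      (1 - s) * dC S x a ^ 2 + s * dC S x b ^ 2 - s * (1 - s) * dC S a b ^ 2 := by
  by_cases hxa : Vis S x a <;> by_cases hxb : Vis S x b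
  · rw [dC_vis (fill hS haR hbR hxR hab hxa hxb h0 h1), sq_comb, dC_vis hxa, dC_vis hxb, dC_vis hab]
  · exact cnA3 hS haR hbR hxR hab hxa hxb h0 h1
  · have := cnA3 hS hbR haR hxR hab.symm hxb hxa (s := 1 - s) (by linarith) (by linarith)
    rw [dC_symm S a b]
    convert this using 1
    · congr 2; rw [add_comm]; simp
    · ring
  · rw [dC_nvis hxa, dC_nvis hxb, dC_vis hab]
    set g := (1 - s) • a + s • b with hg
    have h := dC_le S x g
    have hn := dC_nonneg S x g
    have hsq : dC S x g ^ 2 ≤ (‖x‖ + ‖g‖) ^ 2 := by gcongr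
    refine hsq.trans ?_
    have hid := sq_comb a b 0 s
    rw [← hg] at hid
    simp only [zero_sub, norm_neg] at hid
    have hg1 : ‖g‖ ≤ (1 - s) * ‖a‖ + s * ‖b‖ := by
      have := norm_add_le ((1 - s) • a) (s • b)
      rw [norm_smul, norm_smul, Real.norm_of_nonneg h0,
        Real.norm_of_nonneg (by linarith : 0 ≤ 1 - s)] at this
      exact this
    nlinarith [mul_le_mul_of_nonneg_left hg1 (norm_nonneg x)]

/-- The half of the non-visible case. -/
lemma cnB {S : Set E2} {R : ℝ} (hS : ConeLike S R) {a b : E2} (ha : a ∈ S) (hb : b ∈ S) (haR : ‖a‖ < R)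
    (hbR : ‖b‖ < R) (hab : ¬ Vis S a b)
    {s : ℝ} (h0 : 0 ≤ s) (h1 : s ≤ 1) (hs : s * (‖a‖ + ‖b‖) ≤ ‖a‖) :
    ∃ g ∈ S, ‖g‖ ≤ ‖a‖ ∧ dC S a g ≤ s * dC S a b ∧ dC S g b ≤ (1 - s) * dC S a b ∧
    ∀ x ∈ S, ‖x‖ < R → dC S x g ^ 2 ≤
      (1 - s) * dC S x a ^ 2 + s * dC S x b ^ 2 - s * (1 - s) * dC S a b ^ 2 := by
  have ha0 : a ≠ 0 := by rintro rfl; exact hab (vis_zero hS hb hbR)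
  have hna : 0 < ‖a‖ := norm_pos_iff.2 ha0
  set ρ := (‖a‖ - s * (‖a‖ + ‖b‖)) / ‖a‖ with hρ
  have hρ0 : 0 ≤ ρ := div_nonneg (by linarith) hna.le
  have hρ1 : ρ ≤ 1 := by
    rw [hρ, div_le_one hna]
    have : 0 ≤ s * (‖a‖ + ‖b‖) := by positivity
    linarith
  have hng : ‖ρ • a‖ = ‖a‖ - s * (‖a‖ + ‖b‖) := by
    rw [norm_smul, Real.norm_of_nonneg hρ0, hρ]; field_simp
  have hgle : ‖ρ • a‖ ≤ ‖a‖ := by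
    rw [hng]; have : 0 ≤ s * (‖a‖ + ‖b‖) := by positivity
    linarith
  have hgR : ‖ρ • a‖ < R := hgle.trans_lt haR
  have hgS : ρ • a ∈ S := hS.2 a ha haR ρ hρ0 hgR
  refine ⟨ρ • a, hgS, hgle, ?_, ?_, ?_⟩
  · rw [dC_vis (vis_smul hS ha haR hgS hgR), dC_nvis hab]
    have : a - ρ • a = (1 - ρ) • a := by module
    rw [this, norm_smul, Real.norm_of_nonneg (by linarith), hρ]
    field_simp; linarith
  · rw [dC_nvis hab]
    refine (dC_le _ _ _).trans ?_
    rw [hng]; linarith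
  · intro x hx hxR
    rw [dC_nvis hab]
    set κ := ‖b‖ / ‖a‖ with hκ
    have hκa : κ * ‖a‖ = ‖b‖ := by rw [hκ]; field_simp
    have hκ0 : 0 ≤ κ := by positivity
    have hge : ρ • a = (1 - s) • a + s • (-(κ • a)) := by
      have : ρ = (1 - s) - s * κ := by rw [hρ, hκ]; field_simp; ring
      rw [this]; module
    by_cases hxa : Vis S x a
    · have hz : Vis S 0 a := vis_zero hS ha haR
      have hxg : Vis S x (ρ • a) := by
        have := fill hS haR (b := 0) (by simpa using hna.trans haR) hxR hz.symm hxa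
          (vis_zero hS hx hxR).symm (s := 1 - ρ) (by linarith) (by linarith)
        simpa using this
      rw [dC_vis hxg, dC_vis hxa, hge, sq_comb]
      have e1 : ‖a - -(κ • a)‖ = ‖a‖ + ‖b‖ := by
        have : a - -(κ • a) = (1 + κ) • a := by module
        rw [this, norm_smul, Real.norm_of_nonneg (by positivity), add_mul, hκa, one_mul]
      rw [e1]
      have e2 : ‖x - -(κ • a)‖ ^ 2 ≤ dC S x b ^ 2 := by
        have en : ‖-(κ • a)‖ = ‖b‖ := by
          rw [norm_neg, norm_smul, Real.norm_of_nonneg hκ0, hκa]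
        by_cases hxb : Vis S x b
        · rw [dC_vis hxb, sq_sub, sq_sub, en, inner_neg_right, inner_smul_right]
          obtain ⟨α, β, hα, hβ, hxe⟩ := key hS ha haR hb hbR hxR hab hxa.symm hxb.symm
          have i1 : inner ℝ x a = -(α * ‖a‖ ^ 2 + β * inner ℝ a b) := by
            rw [hxe]
            simp only [inner_neg_left, inner_add_left, inner_smul_left, real_inner_self_eq_norm_sq,
              real_inner_comm a b]; simp
          have i2 : inner ℝ x b = -(α * inner ℝ a b + β * ‖b‖ ^ 2) := by
            rw [hxe]
            simp only [inner_neg_left, inner_add_left, inner_smul_left, real_inner_self_eq_norm_sq,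
              real_inner_comm a b]; simp
          have hcs := neg_le_of_abs_le (abs_real_inner_le_norm a b)
          have : ‖a‖ * (inner ℝ x b + κ * inner ℝ x a) ≤ ‖a‖ * 0 := by
            have : ‖a‖ * (inner ℝ x b + κ * inner ℝ x a) = ‖a‖ * inner ℝ x b + ‖b‖ * inner ℝ x a := by
              rw [← hκa]; ring
            rw [this, i1, i2]
            have a3 : 0 ≤ (α * ‖a‖ + β * ‖b‖) * (inner ℝ a b + ‖a‖ * ‖b‖) := by
              apply mul_nonneg <;> [positivity; linarith]
            nlinarith
          have := le_of_mul_le_mul_left this hna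
          linarith
        · rw [dC_nvis hxb]
          have := norm_sub_le x (-(κ • a))
          rw [en] at this
          gcongr
      nlinarith
    · rw [dC_nvis hxa]
      have h := dC_le S x (ρ • a)
      have hn := dC_nonneg S x (ρ • a)
      have hsq : dC S x (ρ • a) ^ 2 ≤ (‖x‖ + ‖ρ • a‖) ^ 2 := by gcongr
      refine hsq.trans ?_
      have hb2 : (‖x‖ - ‖b‖) ^ 2 ≤ dC S x b ^ 2 := by
        rw [← sq_abs (‖x‖ - ‖b‖)]
        have := (abs_norm_sub_norm_le x b).trans (dC_ge S x b)
        gcongr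
      rw [hng]
      nlinarith [mul_le_mul_of_nonneg_left hb2 h0]

theorem cone_cn {S : Set E2} {R : ℝ} (hS : ConeLike S R) {a b : E2} (ha : a ∈ S) (hb : b ∈ S)
    {R' : ℝ} (hR' : R' ≤ R) (haR : ‖a‖ < R') (hbR : ‖b‖ < R')
    {s : ℝ} (h0 : 0 ≤ s) (h1 : s ≤ 1) :
    ∃ g ∈ S, ‖g‖ < R' ∧ dC S a g ≤ s * dC S a b ∧ dC S g b ≤ (1 - s) * dC S a b ∧
    ∀ x ∈ S, ‖x‖ < R' → dC S x g ^ 2 ≤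
      (1 - s) * dC S x a ^ 2 + s * dC S x b ^ 2 - s * (1 - s) * dC S a b ^ 2 := by
  by_cases hab : Vis S a b
  · refine ⟨_, hab s h0 h1, norm_comb_lt haR hbR h0 h1, ?_, ?_, fun x hx hxR =>
      cnA hS (haR.trans_le hR') (hbR.trans_le hR') (hxR.trans_le hR') hab h0 h1⟩
    · rw [dC_vis hab, dC_vis (vis_sub hab h0 h1)]
      have : a - ((1 - s) • a + s • b) = s • (a - b) := by module
      rw [this, norm_smul, Real.norm_of_nonneg h0]
    · have hbg := vis_sub hab.symm (s := 1 - s) (by linarith) (by linarith)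
      have e : (1 - (1 - s)) • b + (1 - s) • a = (1 - s) • a + s • b := by module
      rw [e] at hbg
      rw [dC_vis hab, dC_vis hbg.symm]
      have : ((1 - s) • a + s • b) - b = (1 - s) • (a - b) := by module
      rw [this, norm_smul, Real.norm_of_nonneg (by linarith)]
  · rcases le_total (s * (‖a‖ + ‖b‖)) ‖a‖ with hs | hs
    · obtain ⟨g, hg, hn, h2, h3, h4⟩ := cnB hS ha hb (haR.trans_le hR') (hbR.trans_le hR') hab h0 h1 hs
      exact ⟨g, hg, hn.trans_lt haR, h2, h3, fun x hx hxR => h4 x hx (hxR.trans_le hR')⟩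
    · obtain ⟨g, hg, hn, h2, h3, h4⟩ := cnB hS hb ha (hbR.trans_le hR') (haR.trans_le hR')
        (fun h => hab h.symm) (s := 1 - s) (by linarith) (by linarith) (by linarith)
      refine ⟨g, hg, hn.trans_lt hbR, ?_, ?_, fun x hx hxR => ?_⟩
      · rw [dC_symm S a g, dC_symm S a b]; simpa using h3
      · rw [dC_symm S g b, dC_symm S a b]; exact h2
      · have := h4 x hx (hxR.trans_le hR')
        rw [dC_symm S a b]
        linarith

def LocCN (Z : Type*) [MetricSpace Z] (r : ℝ) : Prop :=
  ∀ a b : Z, dist a b < r → ∀ s : ℝ, 0 ≤ s → s ≤ 1 → ∃ g : Z,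
    dist a g ≤ s * dist a b ∧ dist g b ≤ (1 - s) * dist a b ∧
    ∀ x, dist a x < r →
      dist x g ^ 2 ≤ (1 - s) * dist x a ^ 2 + s * dist x b ^ 2 - s * (1 - s) * dist a b ^ 2

section
variable {Z : Type*} [MetricSpace Z] {r : ℝ}

open Classical in
def gG (r : ℝ) (a b : Z) (s : ℝ) : Z :=
  if h : ∃ g : Z, dist a g ≤ s * dist a b ∧ dist g b ≤ (1 - s) * dist a b ∧
    ∀ x, dist a x < r →
      dist x g ^ 2 ≤ (1 - s) * dist x a ^ 2 + s * dist x b ^ 2 - s * (1 - s) * dist a b ^ 2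
  then h.choose else a

lemma gG_spec (hZ : LocCN Z r) {a b : Z} (h : dist a b < r) {s : ℝ} (h0 : 0 ≤ s) (h1 : s ≤ 1) :
    dist a (gG r a b s) ≤ s * dist a b ∧ dist (gG r a b s) b ≤ (1 - s) * dist a b ∧
    ∀ x, dist a x < r →
      dist x (gG r a b s) ^ 2 ≤
        (1 - s) * dist x a ^ 2 + s * dist x b ^ 2 - s * (1 - s) * dist a b ^ 2 := by
  have H := hZ a b h s h0 h1
  unfold gG
  rw [dif_pos H]
  exact H.choose_spec

lemma gG_uniq (hZ : LocCN Z r) {a b : Z} (h : dist a b < r) {s : ℝ} (h0 : 0 ≤ s) (h1 : s ≤ 1)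
    {w : Z} (hw1 : dist a w ≤ s * dist a b) (hw2 : dist w b ≤ (1 - s) * dist a b) :
    w = gG r a b s := by
  have H := (gG_spec hZ h h0 h1).2.2 w (by nlinarith [dist_nonneg (x := a) (y := b)])
  have e1 : dist w a ^ 2 ≤ (s * dist a b) ^ 2 := by
    rw [dist_comm w a]; exact pow_le_pow_left₀ dist_nonneg hw1 2
  have e2 : dist w b ^ 2 ≤ ((1 - s) * dist a b) ^ 2 := pow_le_pow_left₀ dist_nonneg hw2 2
  have e3 := mul_le_mul_of_nonneg_left e1 (by linarith : 0 ≤ 1 - s)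
  have e4 := mul_le_mul_of_nonneg_left e2 h0
  have : dist w (gG r a b s) ^ 2 ≤ 0 := by nlinarith
  have h2 : dist w (gG r a b s) = 0 := by
    have := le_antisymm this (sq_nonneg _)
    exact pow_eq_zero_iff (two_ne_zero) |>.1 this
  exact dist_eq_zero.1 h2

lemma gG_symm (hZ : LocCN Z r) {a b : Z} (h : dist a b < r) {s : ℝ} (h0 : 0 ≤ s) (h1 : s ≤ 1) :
    gG r b a (1 - s) = gG r a b s := by
  have h' : dist b a < r := by rwa [dist_comm]
  obtain ⟨e1, e2, -⟩ := gG_spec hZ h' (s := 1 - s) (by linarith) (by linarith)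
  apply gG_uniq hZ h h0 h1
  · rw [dist_comm a, dist_comm a]; simpa using e2
  · rw [dist_comm _ b, dist_comm a]; simpa using e1

lemma gG_zero (hZ : LocCN Z r) {a b : Z} (h : dist a b < r) : gG r a b 0 = a := by
  symm; apply gG_uniq hZ h le_rfl zero_le_one <;> simp

lemma gG_one (hZ : LocCN Z r) {a b : Z} (h : dist a b < r) : gG r a b 1 = b := by
  symm; apply gG_uniq hZ h zero_le_one le_rfl <;> simp

lemma gG_param (hZ : LocCN Z r) {a b : Z} (h : dist a b < r) {s t : ℝ} (h0 : 0 ≤ s) (h1 : s ≤ 1)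
    (t0 : 0 ≤ t) (t1 : t ≤ 1) : dist (gG r a b t) (gG r a b s) ≤ |t - s| * dist a b := by
  obtain ⟨a1, a2, -⟩ := gG_spec hZ h t0 t1
  have H := (gG_spec hZ h h0 h1).2.2 (gG r a b t)
    (by nlinarith [dist_nonneg (x := a) (y := b)])
  have e1 : dist (gG r a b t) a ^ 2 ≤ (t * dist a b) ^ 2 := by
    rw [dist_comm _ a]; exact pow_le_pow_left₀ dist_nonneg a1 2
  have e2 : dist (gG r a b t) b ^ 2 ≤ ((1 - t) * dist a b) ^ 2 := pow_le_pow_left₀ dist_nonneg a2 2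
  have e3 := mul_le_mul_of_nonneg_left e1 (by linarith : 0 ≤ 1 - s)
  have e4 := mul_le_mul_of_nonneg_left e2 h0
  apply (pow_le_pow_iff_left₀ dist_nonneg (by positivity) two_ne_zero).1
  rw [mul_pow, sq_abs]
  nlinarith

lemma gG_B1 (hZ : LocCN Z r) {a b c : Z} (h : dist a b < r) (h' : dist a c < r)
    {s : ℝ} (h0 : 0 ≤ s) (h1 : s ≤ 1) :
    dist (gG r a b s) (gG r a c s) ≤ s * dist b c := by
  obtain ⟨a1, a2, a3⟩ := gG_spec hZ h h0 h1
  obtain ⟨b1, b2, b3⟩ := gG_spec hZ h' h0 h1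
  have H := b3 (gG r a b s) (by nlinarith [dist_nonneg (x := a) (y := b)])
  have H2 := a3 c h'
  have e1 : dist (gG r a b s) a ^ 2 ≤ (s * dist a b) ^ 2 := by
    rw [dist_comm _ a]; exact pow_le_pow_left₀ dist_nonneg a1 2
  have e3 := mul_le_mul_of_nonneg_left e1 (by linarith : 0 ≤ 1 - s)
  have e4 := mul_le_mul_of_nonneg_left H2 h0
  apply (pow_le_pow_iff_left₀ dist_nonneg (by positivity) two_ne_zero).1
  rw [dist_comm c (gG r a b s), dist_comm c a, dist_comm c b] at *
  nlinarith

lemma gG_B2 (hZ : LocCN Z r) {a b a' b' : Z} (h : dist a b < r) (h' : dist a' b' < r)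
    (h'' : dist a b' < r)
    {s : ℝ} (h0 : 0 ≤ s) (h1 : s ≤ 1) :
    dist (gG r a b s) (gG r a' b' s) ≤ (1 - s) * dist a a' + s * dist b b' := by
  have e1 := gG_B1 hZ h h'' h0 h1
  have e2 := gG_B1 hZ (a := b') (b := a) (c := a') (by rwa [dist_comm]) (by rwa [dist_comm])
    (s := 1 - s) (by linarith) (by linarith)
  rw [gG_symm hZ h'' h0 h1, gG_symm hZ h' h0 h1] at e2
  have := dist_triangle (gG r a b s) (gG r a b' s) (gG r a' b' s)
  linarith

lemma gG_cont (hZ : LocCN Z r) {T : Type*} [TopologicalSpace T] {γ η : T → Z} {s : T → ℝ}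
    (hγ : Continuous γ) (hη : Continuous η) (hs : Continuous s) (hd : ∀ t, dist (γ t) (η t) < r)
    (h0 : ∀ t, 0 ≤ s t) (h1 : ∀ t, s t ≤ 1) :
    Continuous (fun t => gG r (γ t) (η t) (s t)) := by
  rw [continuous_iff_continuousAt]
  intro t₀
  unfold ContinuousAt
  rw [tendsto_iff_dist_tendsto_zero]
  have hlim : Filter.Tendsto (fun t => |s t - s t₀| * dist (γ t) (η t) +
      ((1 - s t₀) * dist (γ t) (γ t₀) + s t₀ * dist (η t) (η t₀))) (nhds t₀) (nhds 0) := by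
    have : Continuous (fun t => |s t - s t₀| * dist (γ t) (η t) +
      ((1 - s t₀) * dist (γ t) (γ t₀) + s t₀ * dist (η t) (η t₀))) := by fun_prop
    have := this.tendsto t₀
    simpa using this
  refine squeeze_zero' (Filter.Eventually.of_forall fun _ => dist_nonneg) ?_ hlim
  have hev : ∀ᶠ t in nhds t₀, dist (γ t) (η t₀) < r := by
    have : Continuous (fun t => dist (γ t) (η t₀)) := by fun_prop
    exact this.continuousAt.eventually_lt continuousAt_const (hd t₀)
  filter_upwards [hev] with t ht
  have e1 := gG_param hZ (hd t) (h0 t₀) (h1 t₀) (h0 t) (h1 t)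
  have e2 := gG_B2 hZ (hd t) (hd t₀) ht (h0 t₀) (h1 t₀)
  exact (dist_triangle _ _ _).trans (add_le_add e1 e2)

end

section

instance contractI : ContractibleSpace unitInterval :=
  Convex.contractibleSpace (convex_Icc (0:ℝ) 1) ⟨0, by simp⟩

def segI (t t' : unitInterval) : Path t t' where
  toFun s := ⟨(1 - s.1) * t.1 + s.1 * t'.1, subIcc_mem s t t'⟩
  continuous_toFun := Continuous.subtype_mk (by fun_prop) _
  source' := Subtype.ext (by simp)
  target' := Subtype.ext (by simp)

lemma segI_val (t t' s : unitInterval) : ((segI t t' s : unitInterval) : ℝ) = (1 - s.1) * t.1 + s.1 * t'.1 := rfl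

variable {Z : Type*} [MetricSpace Z] {r : ℝ}

lemma const_trans_aux {Z : Type*} [TopologicalSpace Z] {x y z : Z} (h : y = x) (A : Path x y) (hA : ∀ s, A s = x) (Q : Path y z)
    (η : Path x z) (hη : ∀ u, η u = Q u) : (A.trans Q).Homotopic η := by
  subst h
  have e1 : A = Path.refl y := by ext s; simpa using hA s
  have e2 : η = Q := by ext s; exact hη s
  subst e1 e2
  exact ⟨Path.Homotopy.reflTrans η⟩

lemma square {Z : Type*} [TopologicalSpace Z] {H : unitInterval × unitInterval → Z} (hH : Continuous H) {p q q' : Z} (γ : Path p q)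
    (e : Path q q') (η : Path p q') (h1 : ∀ u, H (0, u) = γ u) (h2 : ∀ u, H (1, u) = η u)
    (h3 : ∀ s, H (s, 1) = e s) (h4 : ∀ s, H (s, 0) = p) : (γ.trans e).Homotopic η := by
  let P1 : Path ((0:unitInterval), (0:unitInterval)) (0, 1) :=
    ⟨⟨fun u => (0, u), by fun_prop⟩, rfl, rfl⟩
  let P2 : Path ((0:unitInterval), (1:unitInterval)) (1, 1) :=
    ⟨⟨fun u => (u, 1), by fun_prop⟩, rfl, rfl⟩
  let P3 : Path ((0:unitInterval), (0:unitInterval)) (1, 0) :=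
    ⟨⟨fun u => (u, 0), by fun_prop⟩, rfl, rfl⟩
  let P4 : Path ((1:unitInterval), (0:unitInterval)) (1, 1) :=
    ⟨⟨fun u => (1, u), by fun_prop⟩, rfl, rfl⟩
  have hh : (P1.trans P2).Homotopic (P3.trans P4) := SimplyConnectedSpace.paths_homotopic _ _
  have hh2 := hh.map ⟨H, hH⟩
  simp only [ContinuousMap.coe_mk, Path.map_trans] at hh2
  have hp : H (0, 0) = p := h4 0
  have hq : H (0, 1) = q := by rw [h1]; simp
  have hq' : H (1, 1) = q' := by rw [h2]; simp
  subst hp hq hq'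
  have e1 : γ = P1.map hH := by ext u; exact (h1 u).symm
  have e2 : e = P2.map hH := by ext u; exact (h3 u).symm
  rw [e1, e2]
  refine hh2.trans ?_
  exact const_trans_aux (h4 1) _ (fun s => h4 s) _ _ (fun u => (h2 u).symm)

def gPath (hZ : LocCN Z r) {a b : Z} (h : dist a b < r) : Path a b where
  toFun s := gG r a b s.1
  continuous_toFun := gG_cont hZ continuous_const continuous_const continuous_subtype_val
    (fun _ => h) (fun t => t.2.1) (fun t => t.2.2)
  source' := gG_zero hZ h
  target' := gG_one hZ h

def cP (c : C(unitInterval, Z)) (t t' : unitInterval) : Path (c t) (c t') :=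
  (segI t t').map c.continuous

lemma cP_trans (c : C(unitInterval, Z)) (t t' t'' : unitInterval) :
    ((cP c t t').trans (cP c t' t'')).Homotopic (cP c t t'') := by
  unfold cP
  rw [← Path.map_trans]
  exact (SimplyConnectedSpace.paths_homotopic ((segI t t').trans (segI t' t'')) (segI t t'')).map c

lemma close_hom (hZ : LocCN Z r) {p : Z} {c : C(unitInterval, Z)} {K : ℝ}
    (hc : ∀ s t, dist (c s) (c t) = K * |s.1 - t.1|) {t t' : unitInterval}
    (γ : Path p (c t)) (η : Path p (c t')) (h : ∀ u, dist (γ u) (η u) < r) :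
    (γ.trans (cP c t t')).Homotopic η := by
  have hK : 0 ≤ K := by
    have := hc 1 0
    simp at this
    rw [← this]; exact dist_nonneg
  refine square (H := fun q => gG r (γ q.2) (η q.2) q.1.1) ?_ γ _ η ?_ ?_ ?_ ?_
  · exact gG_cont hZ (γ.continuous.comp continuous_snd) (η.continuous.comp continuous_snd)
      (by fun_prop) (fun t => h _) (fun t => t.1.2.1) (fun t => t.1.2.2)
  · intro u; exact gG_zero hZ (h u)
  · intro u; exact gG_one hZ (h u)
  · intro s
    have h1 := h 1
    simp only [Path.target] at h1 ⊢
    symm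
    have hs := s.2
    apply gG_uniq hZ h1 s.2.1 s.2.2
    · show dist (c t) (c (segI t t' s)) ≤ _
      rw [hc, hc, segI_val]
      have : t.1 - ((1 - s.1) * t.1 + s.1 * t'.1) = s.1 * (t.1 - t'.1) := by ring
      rw [this, abs_mul, abs_of_nonneg s.2.1]
      apply le_of_eq; ring
    · show dist (c (segI t t' s)) (c t') ≤ _
      rw [hc, hc, segI_val]
      have : ((1 - s.1) * t.1 + s.1 * t'.1) - t'.1 = (1 - s.1) * (t.1 - t'.1) := by ring
      rw [this, abs_mul, abs_of_nonneg (by linarith [s.2.2] : 0 ≤ 1 - s.1)]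
      apply le_of_eq; ring
  · intro s
    have h0 := h 0
    simp only [Path.source] at h0 ⊢
    symm
    apply gG_uniq hZ h0 s.2.1 s.2.2 <;> simp

lemma close_hom' (hZ : LocCN Z r) {p q : Z} 
    (γ η : Path p q) (h : ∀ u, dist (γ u) (η u) < r) : γ.Homotopic η := by
  have := close_hom hZ (c := ContinuousMap.const _ q) (K := 0) (by simp) (t := 0) (t' := 0) γ η h
  refine Path.Homotopic.trans ?_ this
  have e : cP (ContinuousMap.const unitInterval q) 0 0 = Path.refl q := by ext s; rfl
  rw [e]
  exact ⟨(Path.Homotopy.transRefl γ).symm⟩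

def InP {p : Z} {c : C(unitInterval, Z)} (σ : Path p (c 0)) {t : unitInterval}
    (γ : Path p (c t)) : Prop := γ.Homotopic (σ.trans (cP c 0 t))

lemma InP.append {p : Z} {c : C(unitInterval, Z)} {σ : Path p (c 0)} {t : unitInterval}
    {γ : Path p (c t)} (h : InP σ γ) (t' : unitInterval) : InP σ (γ.trans (cP c t t')) := by
  unfold InP at *
  have h1 : (γ.trans (cP c t t')).Homotopic ((σ.trans (cP c 0 t)).trans (cP c t t')) :=
    h.hcomp (Path.Homotopic.refl _)
  refine h1.trans (Path.Homotopic.trans ⟨Path.Homotopy.transAssoc _ _ _⟩ ?_)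
  exact (Path.Homotopic.refl _).hcomp (cP_trans c 0 t t')

lemma InP.close (hZ : LocCN Z r) {p : Z} {c : C(unitInterval, Z)} {K : ℝ}
    (hc : ∀ s t, dist (c s) (c t) = K * |s.1 - t.1|) {σ : Path p (c 0)} {t t' : unitInterval}
    {γ : Path p (c t)} (h : InP σ γ) {η : Path p (c t')} (hd : ∀ u, dist (γ u) (η u) < r) :
    InP σ η :=
  (close_hom hZ hc γ η hd).symm.trans (h.append t')

lemma InP.hom {p : Z} {c : C(unitInterval, Z)} {σ : Path p (c 0)} {t : unitInterval}
    {γ γ' : Path p (c t)} (h : InP σ γ) (h' : γ'.Homotopic γ) : InP σ γ' := h'.trans h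

def plen {Z : Type*} [MetricSpace Z] {x y : Z} (γ : Path x y) : ENNReal := eVariationOn γ Set.univ

lemma evar_trans {Z' : Type*} [MetricSpace Z'] {Z : Type*} [TopologicalSpace Z] (g : Z → Z')
    {x y z : Z} (γ : Path x y) (γ' : Path y z) :
    eVariationOn (fun t => g (γ.trans γ' t)) Set.univ ≤
      eVariationOn (fun t => g (γ t)) Set.univ + eVariationOn (fun t => g (γ' t)) Set.univ := by
  let hf : unitInterval := ⟨1/2, by norm_num, by norm_num⟩
  have hsplit := eVariationOn.Icc_add_Icc (fun t => g (γ.trans γ' t)) (s := Set.univ)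
    (a := (0 : unitInterval)) (b := hf) (c := 1) unitInterval.nonneg' unitInterval.le_one' (Set.mem_univ _)
  have hU : Set.univ ∩ Set.Icc (0:unitInterval) 1 = Set.univ := by
    ext t; simp [unitInterval.le_one']
  rw [hU] at hsplit
  rw [← hsplit]
  apply add_le_add
  · have : Set.EqOn (fun t => g (γ.trans γ' t))
      ((fun t => g (γ t)) ∘ (fun t : unitInterval => Set.projIcc (0:ℝ) 1 zero_le_one (2 * t.1)))
        (Set.univ ∩ Set.Icc 0 hf) := by
      rintro t ⟨-, ht⟩
      have ht' : (t:ℝ) ≤ 1/2 := ht.2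
      simp only [Path.trans_apply, Function.comp]
      rw [dif_pos ht']
      congr 2
      rw [Set.projIcc_of_mem]
    rw [eVariationOn.eq_of_eqOn this]
    apply eVariationOn.comp_le_of_monotoneOn
    · intro a _ b _ hab
      apply Set.monotone_projIcc
      have : a.1 ≤ b.1 := hab
      linarith
    · intro _ _; trivial
  · have : Set.EqOn (fun t => g (γ.trans γ' t))
      ((fun t => g (γ' t)) ∘ (fun t : unitInterval => Set.projIcc (0:ℝ) 1 zero_le_one (2 * t.1 - 1)))
        (Set.univ ∩ Set.Icc hf 1) := by
      rintro t ⟨-, ht⟩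
      have ht' : 1/2 ≤ (t:ℝ) := ht.1
      simp only [Path.trans_apply, Function.comp]
      split_ifs with h
      · have h12 : (t:ℝ) = 1/2 := le_antisymm h ht'
        have e1 : (⟨2 * t.1, (unitInterval.mul_pos_mem_iff zero_lt_two).2 ⟨t.2.1, h⟩⟩ : unitInterval) = 1 := by
          apply Subtype.ext; simp [h12]
        have e2 : Set.projIcc (0:ℝ) 1 zero_le_one (2 * t.1 - 1) = 0 := by
          rw [h12]; norm_num
        rw [e2, e1]; simp
      · congr 2
        rw [Set.projIcc_of_mem]
    rw [eVariationOn.eq_of_eqOn this]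
    apply eVariationOn.comp_le_of_monotoneOn
    · intro a _ b _ hab
      apply Set.monotone_projIcc
      have : a.1 ≤ b.1 := hab
      linarith
    · intro _ _; trivial

lemma plen_trans {x y z : Z} (γ : Path x y) (γ' : Path y z) :
    plen (γ.trans γ') ≤ plen γ + plen γ' := evar_trans id γ γ'

lemma plen_lip {x y : Z} (γ : Path x y) {L : ℝ} (h : ∀ s t, dist (γ s) (γ t) ≤ L * |s.1 - t.1|) :
    plen γ ≤ ENNReal.ofReal L := by
  have hL : 0 ≤ L := by
    have := h 1 0
    simp at this
    exact dist_nonneg.trans this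
  unfold plen
  apply iSup_le
  rintro ⟨n, u, hu, -⟩
  calc ∑ i ∈ Finset.range n, edist (γ (u (i+1))) (γ (u i))
      ≤ ∑ i ∈ Finset.range n, ENNReal.ofReal (L * ((u (i+1)).1 - (u i).1)) := by
        apply Finset.sum_le_sum
        intro i _
        rw [edist_dist]
        apply ENNReal.ofReal_le_ofReal
        have h2 : (u i).1 ≤ (u (i+1)).1 := hu (Nat.le_succ i)
        have := h (u (i+1)) (u i)
        rwa [abs_of_nonneg (by linarith)] at this
    _ = ENNReal.ofReal (∑ i ∈ Finset.range n, (L * ((u (i+1)).1 - (u i).1))) := by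
        rw [ENNReal.ofReal_sum_of_nonneg]
        intro i _
        have h2 : (u i).1 ≤ (u (i+1)).1 := hu (Nat.le_succ i)
        exact mul_nonneg hL (by linarith)
    _ ≤ ENNReal.ofReal L := by
        apply ENNReal.ofReal_le_ofReal
        rw [← Finset.mul_sum, Finset.sum_range_sub (fun i => (u i).1)]
        have := (u n).2.2
        have := (u 0).2.1
        nlinarith

lemma plen_cP {c : C(unitInterval, Z)} {K : ℝ}
    (hc : ∀ s t, dist (c s) (c t) = K * |s.1 - t.1|) (t t' : unitInterval) :
    plen (cP c t t') ≤ ENNReal.ofReal (K * |t.1 - t'.1|) := by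
  apply plen_lip
  intro s u
  show dist (c (segI t t' s)) (c (segI t t' u)) ≤ _
  rw [hc, segI_val, segI_val]
  have : (1 - s.1) * t.1 + s.1 * t'.1 - ((1 - u.1) * t.1 + u.1 * t'.1) = (t.1 - t'.1) * (u.1 - s.1) := by ring
  rw [this, abs_mul, abs_sub_comm u.1 s.1]
  apply le_of_eq; ring

def pt (m i : ℕ) : unitInterval := Set.projIcc (0:ℝ) 1 zero_le_one ((i:ℝ) / m)

lemma pt_val {m i : ℕ} (h : i ≤ m) : (pt m i).1 = (i:ℝ) / m := by
  unfold pt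
  rw [Set.projIcc_of_mem]
  constructor
  · positivity
  · apply div_le_one_of_le₀ (by exact_mod_cast h) (by positivity)

def Lm (γ : C(unitInterval, Z)) (m : ℕ) : ℝ :=
  ∑ i ∈ Finset.range m, dist (γ (pt m i)) (γ (pt m (i+1)))

lemma gPath_len (hZ : LocCN Z r) {a b : Z} (h : dist a b < r) :
    plen (gPath hZ h) ≤ ENNReal.ofReal (dist a b) := by
  apply plen_lip
  intro s t
  have := gG_param hZ h (s := t.1) (t := s.1) t.2.1 t.2.2 s.2.1 s.2.2
  rw [mul_comm]; exact this

lemma poly_path (hZ : LocCN Z r) (γ : C(unitInterval, Z)) {m : ℕ} {ρ : ℝ} (hρ : 2 * ρ ≤ r)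
    (hm : ∀ u w : unitInterval, |u.1 - w.1| ≤ 1 / m → dist (γ u) (γ w) < ρ) :
    ∀ i ≤ m, ∃ P : Path (γ 0) (γ (pt m i)), P.Homotopic (cP γ 0 (pt m i)) ∧
      plen P ≤ ENNReal.ofReal (∑ j ∈ Finset.range i, dist (γ (pt m j)) (γ (pt m (j+1)))) := by
  intro i
  induction i with
  | zero =>
    intro _
    refine ⟨(cP γ 0 (pt m 0)), Path.Homotopic.refl _, ?_⟩
    apply plen_lip
    intro s t
    show dist (γ (segI 0 _ s)) (γ (segI 0 _ t)) ≤ _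
    have : ∀ s, segI 0 (pt m 0) s = 0 := by
      intro s; apply Subtype.ext; rw [segI_val, pt_val (Nat.zero_le _)]; simp
    rw [this, this]; simp
  | succ i ih =>
    intro hi
    obtain ⟨P, hP, hl⟩ := ih (by omega)
    have hmpos : (0:ℝ) < m := by exact_mod_cast (by omega : 0 < m)
    have v1 := pt_val (m := m) (i := i) (by omega)
    have v2 := pt_val (m := m) (i := i+1) hi
    have hstep : (pt m (i+1)).1 - (pt m i).1 = 1 / m := by
      rw [v1, v2]; push_cast; field_simp; ring
    have hmp : (0:ℝ) ≤ 1 / m := by positivity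
    have hρ0 : 0 < ρ := by
      have := hm 0 0 (by simp)
      simpa using this
    have hd : dist (γ (pt m i)) (γ (pt m (i+1))) < r := by
      have := hm (pt m i) (pt m (i+1)) (by rw [abs_sub_comm, hstep, abs_of_nonneg hmp])
      linarith
    refine ⟨P.trans (gPath hZ hd), ?_, ?_⟩
    · refine Path.Homotopic.trans ?_ (cP_trans γ 0 (pt m i) (pt m (i+1)))
      refine hP.hcomp ?_
      apply close_hom' hZ
      intro u
      have e1 : dist (gPath hZ hd u) (γ (pt m i)) < ρ := by
        have h1 := (gG_spec hZ hd (s := u.1) u.2.1 u.2.2).1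
        have h2 := hm (pt m i) (pt m (i+1)) (by rw [abs_sub_comm, hstep, abs_of_nonneg hmp])
        rw [dist_comm]
        have h3 : u.1 * dist (γ (pt m i)) (γ (pt m (i+1))) ≤ 1 * dist (γ (pt m i)) (γ (pt m (i+1))) :=
          mul_le_mul_of_nonneg_right u.2.2 dist_nonneg
        show dist (γ (pt m i)) (gG r _ _ u.1) < ρ
        linarith
      have e2 : dist (γ (pt m i)) (cP γ (pt m i) (pt m (i+1)) u) < ρ := by
        apply hm _ (segI _ _ u)
        rw [segI_val]
        have : (pt m i).1 - ((1 - u.1) * (pt m i).1 + u.1 * (pt m (i+1)).1) =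
          - (u.1 * ((pt m (i+1)).1 - (pt m i).1)) := by ring
        rw [this, abs_neg, hstep, abs_of_nonneg (mul_nonneg u.2.1 hmp)]
        exact mul_le_of_le_one_left hmp u.2.2
      have := dist_triangle (gPath hZ hd u) (γ (pt m i)) (cP γ (pt m i) (pt m (i+1)) u)
      linarith
    · refine (plen_trans _ _).trans ?_
      rw [Finset.sum_range_succ, ENNReal.ofReal_add (Finset.sum_nonneg fun _ _ => dist_nonneg) dist_nonneg]
      exact add_le_add hl (gPath_len hZ hd)

lemma pt_self {m : ℕ} (h : 0 < m) : pt m m = 1 := by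
  apply Subtype.ext; rw [pt_val le_rfl]
  have : (m:ℝ) ≠ 0 := by exact_mod_cast h.ne'
  simp [this]

lemma poly_path' (hZ : LocCN Z r) {x y : Z} (γ : Path x y) {m : ℕ} (h0 : 0 < m) {ρ : ℝ} (hρ : 2 * ρ ≤ r)
    (hm : ∀ u w : unitInterval, |u.1 - w.1| ≤ 1 / m → dist (γ u) (γ w) < ρ) :
    ∃ P : Path x y, P.Homotopic γ ∧ plen P ≤ ENNReal.ofReal (Lm γ.toContinuousMap m) := by
  obtain ⟨P, hP, hl⟩ := poly_path hZ γ.toContinuousMap hρ hm m le_rfl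
  have e1 : x = γ.toContinuousMap 0 := γ.source.symm
  have e2 : y = γ.toContinuousMap (pt m m) := by rw [pt_self h0]; exact γ.target.symm
  refine ⟨P.cast e1 e2, ?_, hl⟩
  have h3 : (cP γ.toContinuousMap 0 (pt m m)).cast e1 e2 = γ := by
    ext s
    show γ (segI 0 (pt m m) s) = γ s
    congr 1
    apply Subtype.ext; rw [segI_val, pt_self h0]; simp
  have := hP.pathCast e1 e2
  rwa [h3] at this
end

section
variable {Z : Type*} [MetricSpace Z] {r : ℝ}

open Classical in
def mid (r : ℝ) (γ η : C(unitInterval, Z)) : C(unitInterval, Z) :=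
  if h : Continuous (fun u => gG r (γ u) (η u) (1/2)) then ⟨_, h⟩ else γ

lemma mid_apply (hZ : LocCN Z r) {γ η : C(unitInterval, Z)} (hd : ∀ u, dist (γ u) (η u) < r) (u) :
    mid r γ η u = gG r (γ u) (η u) (1/2) := by
  have h : Continuous (fun u => gG r (γ u) (η u) (1/2)) :=
    gG_cont hZ γ.continuous η.continuous continuous_const hd (by norm_num) (by norm_num)
  unfold mid
  rw [dif_pos h]; rfl

structure GoodRows (r K A B : ℝ) {p : Z} {c : C(unitInterval, Z)} (σ : Path p (c 0))
    (n m : ℕ) (a b : unitInterval) (Q : ℝ)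
    (γ : ℕ → C(unitInterval, Z)) (τ : ℕ → unitInterval) : Prop where
  inc : ∀ j ≤ n, ∃ P : Path p (c (τ j)), (∀ u, P u = γ j u) ∧ InP σ P
  nb : ∀ j < n, ∀ u, dist (γ j u) (γ (j+1) u) < r / 4
  uc : ∀ j ≤ n, ∀ u w : unitInterval, |u.1 - w.1| ≤ 1 / m → dist (γ j u) (γ j w) < r / 4
  en : ∀ j ≤ n, Lm (γ j) m + K * |(τ j).1 - ((1 - (j:ℝ)/n) * a.1 + (j:ℝ)/n * b.1)| ≤
    (1 - (j:ℝ)/n) * A + (j:ℝ)/n * B + Q * ((j:ℝ) * (n - j))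

def nextG (r : ℝ) (n : ℕ) (γ : ℕ → C(unitInterval, Z)) : ℕ → C(unitInterval, Z)
  | 0 => γ 0
  | i + 1 => if i + 2 ≤ n then mid r (γ i) (γ (i+2)) else γ (i+1)

def halfI : unitInterval := ⟨1/2, by norm_num, by norm_num⟩

def nextT (n : ℕ) (τ : ℕ → unitInterval) : ℕ → unitInterval
  | 0 => τ 0
  | i + 1 => if i + 2 ≤ n then segI (τ i) (τ (i+2)) halfI else τ (i+1)

lemma seg_half (a b : unitInterval) : (segI a b halfI).1 = (a.1 + b.1) / 2 := by
  rw [segI_val]; simp [halfI]; ring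

lemma gG_c (hZ : LocCN Z r) {c : C(unitInterval, Z)} {K : ℝ}
    (hc : ∀ s t, dist (c s) (c t) = K * |s.1 - t.1|) {t t' : unitInterval}
    (h1 : dist (c t) (c t') < r) (s : unitInterval) :
    gG r (c t) (c t') s.1 = c (segI t t' s) := by
  symm
  apply gG_uniq hZ h1 s.2.1 s.2.2
  · rw [hc, hc, segI_val]
    have : t.1 - ((1 - s.1) * t.1 + s.1 * t'.1) = s.1 * (t.1 - t'.1) := by ring
    rw [this, abs_mul, abs_of_nonneg s.2.1]
    apply le_of_eq; ring
  · rw [hc, hc, segI_val]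
    have : ((1 - s.1) * t.1 + s.1 * t'.1) - t'.1 = (1 - s.1) * (t.1 - t'.1) := by ring
    rw [this, abs_mul, abs_of_nonneg (by linarith [s.2.2] : 0 ≤ 1 - s.1)]
    apply le_of_eq; ring

lemma pt_step {m i : ℕ} (h : i < m) : |(pt m i).1 - (pt m (i+1)).1| ≤ 1 / m := by
  have hmpos : (0:ℝ) < m := by exact_mod_cast (by omega : 0 < m)
  rw [pt_val h.le, pt_val h]
  have : (i:ℝ) / m - ((i+1 : ℕ):ℝ) / m = - (1 / m) := by push_cast; field_simp; ring
  rw [this, abs_neg, abs_of_nonneg (by positivity)]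

variable {K A B : ℝ} {p : Z} {c : C(unitInterval, Z)} {σ : Path p (c 0)}
    {n m : ℕ} {a b : unitInterval} {Q : ℝ}
    {γ : ℕ → C(unitInterval, Z)} {τ : ℕ → unitInterval}

lemma rows_next (hZ : LocCN Z r) (hr : 0 < r) (hc : ∀ s t, dist (c s) (c t) = K * |s.1 - t.1|) (hQ : 0 ≤ Q)
    (hn : 0 < n) (H : GoodRows r K A B σ n m a b Q γ τ) :
    GoodRows r K A B σ n m a b (Q * (1 - 1 / (n:ℝ)^2)) (nextG r n γ) (nextT n τ) := by
  have hK : 0 ≤ K := by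
    have := hc 1 0
    simp at this
    rw [← this]; exact dist_nonneg
  have hnr : (0:ℝ) < n := by exact_mod_cast hn
  have d2 : ∀ i, i + 2 ≤ n → ∀ u, dist (γ i u) (γ (i+2) u) < r / 2 := by
    intro i hi u
    have h1 := H.nb i (by omega) u
    have h2 := H.nb (i+1) (by omega) u
    have := dist_triangle (γ i u) (γ (i+1) u) (γ (i+2) u)
    have e : i + 1 + 1 = i + 2 := rfl
    rw [e] at h2
    linarith
  have d2' : ∀ i, i + 2 ≤ n → ∀ u, dist (γ i u) (γ (i+2) u) < r := by
    intro i hi u; linarith [d2 i hi u]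
  have val : ∀ i, i + 2 ≤ n → ∀ u, nextG r n γ (i+1) u = gG r (γ i u) (γ (i+2) u) (1/2) := by
    intro i hi u
    show (if i + 2 ≤ n then mid r (γ i) (γ (i+2)) else γ (i+1)) u = _
    rw [if_pos hi]
    exact mid_apply hZ (d2' i hi) u
  have valT : ∀ i, i + 2 ≤ n → nextT n τ (i+1) = segI (τ i) (τ (i+2)) halfI := by
    intro i hi
    show (if i + 2 ≤ n then segI (τ i) (τ (i+2)) halfI else τ (i+1)) = _
    rw [if_pos hi]
  have valE : ∀ j, (j = 0 ∨ j = n) → nextG r n γ j = γ j ∧ nextT n τ j = τ j := by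
    intro j hj
    rcases j with _ | i
    · exact ⟨rfl, rfl⟩
    · have : ¬ (i + 2 ≤ n) := by omega
      constructor
      · show (if i + 2 ≤ n then mid r (γ i) (γ (i+2)) else γ (i+1)) = _
        rw [if_neg this]
      · show (if i + 2 ≤ n then segI (τ i) (τ (i+2)) halfI else τ (i+1)) = _
        rw [if_neg this]
  have cases : ∀ j ≤ n, (j = 0 ∨ j = n) ∨ ∃ i, j = i + 1 ∧ i + 2 ≤ n := by
    intro j hj
    rcases j with _ | i
    · left; left; rfl
    · by_cases h : i + 1 = n
      · left; right; exact h
      · right; exact ⟨i, rfl, by omega⟩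
  have near1 : ∀ i, i + 2 ≤ n → ∀ u, dist (γ i u) (nextG r n γ (i+1) u) < r / 4 := by
    intro i hi u
    rw [val i hi u]
    have := (gG_spec hZ (d2' i hi u) (s := 1/2) (by norm_num) (by norm_num)).1
    linarith [d2 i hi u]
  have near2 : ∀ i, i + 2 ≤ n → ∀ u, dist (nextG r n γ (i+1) u) (γ (i+2) u) < r / 4 := by
    intro i hi u
    rw [val i hi u]
    have := (gG_spec hZ (d2' i hi u) (s := 1/2) (by norm_num) (by norm_num)).2.1
    linarith [d2 i hi u]
  have contr : ∀ i, i + 2 ≤ n → ∀ u w : unitInterval, |u.1 - w.1| ≤ 1 / m → 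
      dist (nextG r n γ (i+1) u) (nextG r n γ (i+1) w) ≤ 
        (dist (γ i u) (γ i w) + dist (γ (i+2) u) (γ (i+2) w)) / 2 := by
    intro i hi u w huw
    rw [val i hi, val i hi]
    have h3 : dist (γ i u) (γ (i+2) w) < r := by
      have := dist_triangle (γ i u) (γ (i+2) u) (γ (i+2) w)
      have h1 := H.uc (i+2) hi u w huw
      linarith [d2 i hi u]
    have := gG_B2 hZ (d2' i hi u) (d2' i hi w) h3 (s := 1/2) (by norm_num) (by norm_num)
    linarith
  refine ⟨?_, ?_, ?_, ?_⟩
  · intro j hj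
    rcases cases j hj with h | ⟨i, rfl, hi⟩
    · rw [(valE j h).1, (valE j h).2]; exact H.inc j hj
    · obtain ⟨P, hP, hPin⟩ := H.inc i (by omega)
      obtain ⟨P', hP', -⟩ := H.inc (i+2) (by omega)
      have s0 : nextG r n γ (i+1) 0 = p := by
        rw [val i hi, ← hP, ← hP', P.source, P'.source]
        symm; apply gG_uniq hZ <;> simp <;> linarith
      have s1 : nextG r n γ (i+1) 1 = c (nextT n τ (i+1)) := by
        have h1 := d2' i hi 1
        rw [val i hi, valT i hi]
        rw [← hP, ← hP', P.target, P'.target] at h1 ⊢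
        exact gG_c hZ hc h1 halfI
      let P2 : Path p (c (nextT n τ (i+1))) := ⟨nextG r n γ (i+1), s0, s1⟩
      refine ⟨P2, fun u => rfl, ?_⟩
      apply hPin.close hZ hc
      intro u
      rw [hP]
      have : dist (γ i u) (nextG r n γ (i+1) u) < r := by linarith [near1 i hi u]
      exact this
  · intro j hj u
    rcases cases j hj.le with h | ⟨i, rfl, hi⟩
    · have hj0 : j = 0 := by omega
      subst hj0
      rcases cases 1 hj with h' | ⟨i', h'', hi'⟩
      · rw [(valE 0 h).1, (valE _ h').1]; exact H.nb 0 hj u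
      · have : i' = 0 := by omega
        subst this
        rw [(valE 0 h).1]; exact near1 0 hi' u
    · rcases cases (i+1+1) hj with h' | ⟨i', h'', hi'⟩
      · rw [(valE _ h').1]; exact near2 i hi u
      · have : i' = i + 1 := by omega
        subst this
        rw [val i hi, val (i+1) hi']
        have h3 : dist (γ i u) (γ (i+1+2) u) < r := by
          have e1 := d2 i hi u
          have e2 := H.nb (i+2) (by omega) u
          have e : i + 1 + 2 = i + 2 + 1 := by omega
          rw [e]
          have := dist_triangle (γ i u) (γ (i+2) u) (γ (i+2+1) u)
          linarith
        have := gG_B2 hZ (d2' i hi u) (d2' (i+1) hi' u) h3 (s := 1/2) (by norm_num) (by norm_num)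
        have e1 := H.nb i (by omega) u
        have e2 := H.nb (i+2) (by omega) u
        have e : i + 1 + 2 = i + 2 + 1 := by omega
        rw [e] at *
        linarith
  · intro j hj u w huw
    rcases cases j hj with h | ⟨i, rfl, hi⟩
    · rw [(valE j h).1]; exact H.uc j hj u w huw
    · have := contr i hi u w huw
      linarith [H.uc i (by omega) u w huw, H.uc (i+2) hi u w huw]
  · intro j hj
    rcases cases j hj with h | ⟨i, rfl, hi⟩
    · rw [(valE j h).1, (valE j h).2]
      have h0 : (j:ℝ) * (n - j) = 0 := by
        rcases h with rfl | rfl <;> simp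
      have := H.en j hj
      rw [h0] at this ⊢
      simpa using this
    · have hL : Lm (nextG r n γ (i+1)) m ≤ (Lm (γ i) m + Lm (γ (i+2)) m) / 2 := by
        unfold Lm
        rw [← Finset.sum_add_distrib, Finset.sum_div]
        apply Finset.sum_le_sum
        intro k hk
        exact contr i hi _ _ (pt_step (Finset.mem_range.1 hk))
      have e1 := H.en i (by omega)
      have e2 := H.en (i+2) hi
      have hT : (nextT n τ (i+1)).1 = ((τ i).1 + (τ (i+2)).1) / 2 := by
        rw [valT i hi, seg_half]
      set T0 := (1 - (i:ℝ)/n) * a.1 + (i:ℝ)/n * b.1 with hT0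
      set T2 := (1 - ((i+2:ℕ):ℝ)/n) * a.1 + ((i+2:ℕ):ℝ)/n * b.1 with hT2
      have hT1 : (1 - ((i+1:ℕ):ℝ)/n) * a.1 + ((i+1:ℕ):ℝ)/n * b.1 = (T0 + T2) / 2 := by
        rw [hT0, hT2]; push_cast; ring
      have hab : |(nextT n τ (i+1)).1 - (T0 + T2) / 2| ≤ (|(τ i).1 - T0| + |(τ (i+2)).1 - T2|) / 2 := by
        rw [hT]
        have : ((τ i).1 + (τ (i+2)).1) / 2 - (T0 + T2) / 2 = (((τ i).1 - T0) + ((τ (i+2)).1 - T2)) / 2 := by ring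
        rw [this, abs_div, abs_two]
        have := abs_add_le ((τ i).1 - T0) ((τ (i+2)).1 - T2)
        linarith
      rw [hT1]
      have hKa := mul_le_mul_of_nonneg_left hab hK
      have hlin : (1 - ((i+1:ℕ):ℝ)/n) * A + ((i+1:ℕ):ℝ)/n * B =
        (((1 - (i:ℝ)/n) * A + (i:ℝ)/n * B) + ((1 - ((i+2:ℕ):ℝ)/n) * A + ((i+2:ℕ):ℝ)/n * B)) / 2 := by
        push_cast; ring
      have hphi : Q * ((i:ℝ) * (n - i)) + Q * (((i+2:ℕ):ℝ) * (n - (i+2:ℕ))) ≤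
          2 * (Q * (1 - 1 / (n:ℝ)^2) * (((i+1:ℕ):ℝ) * (n - (i+1:ℕ)))) := by
        have hi' : ((i:ℝ) + 2) ≤ n := by exact_mod_cast hi
        have hle : ((i:ℝ)+1) * (n - (i+1)) / (n:ℝ)^2 ≤ 1 := by
          rw [div_le_one (by positivity)]
          have : (0:ℝ) ≤ i := Nat.cast_nonneg i
          nlinarith
        have := mul_le_mul_of_nonneg_left hle hQ
        push_cast
        have e : Q * (1 - 1 / (n:ℝ)^2) * (((i:ℝ)+1) * (n - (i+1))) =
          Q * (((i:ℝ)+1) * (n - (i+1))) - Q * (((i:ℝ)+1) * (n - (i+1)) / (n:ℝ)^2) := by ring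
        rw [e]
        nlinarith
      rw [hlin]
      linarith

lemma rows_eps (hZ : LocCN Z r) (hr : 0 < r) (hc : ∀ s t, dist (c s) (c t) = K * |s.1 - t.1|) (hQ : 0 ≤ Q)
    (hn : 0 < n) (H : GoodRows r K A B σ n m a b Q γ τ) (k : ℕ) :
    ∃ γ' τ', GoodRows r K A B σ n m a b (Q * (1 - 1 / (n:ℝ)^2)^k) γ' τ' := by
  induction k with
  | zero => exact ⟨γ, τ, by simpa using H⟩
  | succ k ih =>
    obtain ⟨γ', τ', h⟩ := ih
    refine ⟨nextG r n γ', nextT n τ', ?_⟩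
    · have hq : 0 ≤ Q * (1 - 1 / (n:ℝ)^2)^k := by
        apply mul_nonneg hQ
        apply pow_nonneg
        have : (1:ℝ) ≤ n := by exact_mod_cast hn
        have : 1 / (n:ℝ)^2 ≤ 1 := by
          rw [div_le_one (by positivity)]; nlinarith
        linarith
      have := rows_next hZ hr hc hq hn h
      rw [mul_assoc, ← pow_succ] at this
      exact this

lemma rows_final (hZ : LocCN Z r) (hr : 0 < r) (hc : ∀ s t, dist (c s) (c t) = K * |s.1 - t.1|) (hQ : 0 ≤ Q)
    (hn : 0 < n) (hm : 0 < m) (H : GoodRows r K A B σ n m a b Q γ τ) {j : ℕ} (hj : j ≤ n) {ε : ℝ} (hε : 0 < ε) :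
    ∃ P : Path p (c (segI a b (pt n j))), InP σ P ∧
      plen P ≤ ENNReal.ofReal ((1 - (j:ℝ)/n) * A + (j:ℝ)/n * B + ε) := by
  have hK : 0 ≤ K := by
    have := hc 1 0
    simp at this
    rw [← this]; exact dist_nonneg
  have hnr : (1:ℝ) ≤ n := by exact_mod_cast hn
  have h1 : 1 / (n:ℝ)^2 ≤ 1 := by rw [div_le_one (by positivity)]; nlinarith
  have h2 : 0 < 1 / (n:ℝ)^2 := by positivity
  obtain ⟨k, hk⟩ : ∃ k : ℕ, Q * (1 - 1 / (n:ℝ)^2)^k * ((j:ℝ) * (n - j)) < ε := by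
    have ht : Filter.Tendsto (fun k : ℕ => Q * (1 - 1 / (n:ℝ)^2)^k * ((j:ℝ) * (n - j))) Filter.atTop (nhds (Q * 0 * ((j:ℝ) * (n - j)))) := by
      refine Filter.Tendsto.mul_const _ (Filter.Tendsto.const_mul _ ?_)
      exact tendsto_pow_atTop_nhds_zero_of_lt_one (by linarith) (by linarith)
    have : ∀ᶠ k in Filter.atTop, Q * (1 - 1 / (n:ℝ)^2)^k * ((j:ℝ) * (n - j)) < ε := by
      apply ht.eventually_lt_const; simpa using hε
    exact this.exists
  obtain ⟨γ', τ', h⟩ := rows_eps hZ hr hc hQ hn H k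
  obtain ⟨P, hP, hin⟩ := h.inc j hj
  have hen := h.en j hj
  obtain ⟨P', hP', hl⟩ := poly_path' hZ P hm (ρ := r/4) (by linarith) (by
    intro u w huw; rw [hP, hP]; exact h.uc j hj u w huw)
  have hLm : Lm P.toContinuousMap m = Lm (γ' j) m := by
    unfold Lm
    apply Finset.sum_congr rfl
    intro i _
    show dist (P _) (P _) = _
    rw [hP, hP]
  rw [hLm] at hl
  refine ⟨P'.trans (cP c (τ' j) _), (hin.hom hP').append _, ?_⟩
  refine (plen_trans _ _).trans ((add_le_add hl (plen_cP hc _ _)).trans ?_)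
  have hLn : 0 ≤ Lm (γ' j) m := Finset.sum_nonneg fun _ _ => dist_nonneg
  rw [← ENNReal.ofReal_add hLn (by positivity)]
  apply ENNReal.ofReal_le_ofReal
  have e : (segI a b (pt n j)).1 = (1 - (j:ℝ)/n) * a.1 + (j:ℝ)/n * b.1 := by
    rw [segI_val, pt_val hj]
  rw [e]
  linarith
end

section
variable {Z : Type*} [MetricSpace Z] {r : ℝ}
variable {K A B : ℝ} {p : Z} {c : C(unitInterval, Z)} {σ : Path p (c 0)}
    {a b : unitInterval}

def endsP (p : Z) (c : C(unitInterval, Z)) (f : C(unitInterval, Z)) : Prop :=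
  f 0 = p ∧ ∃ t, f 1 = c t

lemma hom_with {t : unitInterval} {α α' : Path p (c t)} (h : α.Homotopic α') :
    ContinuousMap.HomotopicWith α.toContinuousMap α'.toContinuousMap (endsP p c) := by
  obtain ⟨H⟩ := h
  refine ⟨⟨H.toHomotopy, ?_⟩⟩
  intro s
  refine ⟨?_, t, ?_⟩
  · exact H.source s
  · exact H.target s

lemma hom_slide (σ : Path p (c 0)) (a b : unitInterval) :
    ContinuousMap.HomotopicWith (σ.trans (cP c 0 a)).toContinuousMap
      (σ.trans (cP c 0 b)).toContinuousMap (endsP p c) := by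
  have hcont := Path.trans_continuous_family (ι := unitInterval) (fun _ : unitInterval => σ)
    (by show Continuous (fun q : unitInterval × unitInterval => σ q.2); fun_prop)
    (fun t => cP c 0 (segI a b t))
    (by
      show Continuous (fun q : unitInterval × unitInterval => c (segI 0 (segI a b q.1) q.2))
      apply c.continuous.comp
      apply Continuous.subtype_mk
      show Continuous (fun q : unitInterval × unitInterval =>
        (1 - q.2.1) * (0:unitInterval).1 + q.2.1 * ((1 - q.1.1) * a.1 + q.1.1 * b.1))
      fun_prop)
  have hcont' : Continuous (fun q : unitInterval × unitInterval => (σ.trans (cP c 0 (segI a b q.1))) q.2) := hcont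
  refine ⟨⟨⟨⟨fun q => (σ.trans (cP c 0 (segI a b q.1))) q.2, hcont'⟩, ?_, ?_⟩, ?_⟩⟩
  · intro u
    show (σ.trans (cP c 0 (segI a b 0))) u = (σ.trans (cP c 0 a)) u
    rw [(segI a b).source]
  · intro u
    show (σ.trans (cP c 0 (segI a b 1))) u = (σ.trans (cP c 0 b)) u
    rw [(segI a b).target]
  · intro s
    refine ⟨?_, segI a b s, ?_⟩
    · exact (σ.trans (cP c 0 (segI a b s))).source
    · exact (σ.trans (cP c 0 (segI a b s))).target

lemma Lm_le {x y : Z} (α : Path x y) (m : ℕ) (hA : 0 ≤ A) (h : plen α ≤ ENNReal.ofReal A) :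
    Lm α.toContinuousMap m ≤ A := by
  have hmono : Monotone (pt m) := by
    intro i j hij
    apply Set.monotone_projIcc
    have : (i:ℝ) ≤ j := by exact_mod_cast hij
    gcongr
  have h1 := (eVariationOn.sum_le (f := α) (s := Set.univ) (n := m) hmono (fun _ => trivial)).trans h
  have h2 : ∑ i ∈ Finset.range m, edist (α (pt m (i+1))) (α (pt m i)) =
      ENNReal.ofReal (Lm α.toContinuousMap m) := by
    unfold Lm
    rw [ENNReal.ofReal_sum_of_nonneg (fun _ _ => dist_nonneg)]
    apply Finset.sum_congr rfl
    intro i _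
    rw [edist_comm, edist_dist]; rfl
  rw [h2] at h1
  exact (ENNReal.ofReal_le_ofReal_iff hA).1 h1

lemma rows_init (hZ : LocCN Z r) (hr : 0 < r) (hc : ∀ s t, dist (c s) (c t) = K * |s.1 - t.1|)
    (hA : 0 ≤ A) (hB : 0 ≤ B) (α : Path p (c a)) (β : Path p (c b)) (hα : InP σ α) (hβ : InP σ β)
    (lα : plen α ≤ ENNReal.ofReal A) (lβ : plen β ≤ ENNReal.ofReal B) :
    ∃ N : ℕ, 0 < N ∧ ∀ n ≥ N, ∃ Q γ τ, 0 ≤ Q ∧ GoodRows r K A B σ n N a b Q γ τ := by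
  have hK : 0 ≤ K := by
    have := hc 1 0
    simp at this
    rw [← this]; exact dist_nonneg
  obtain ⟨H⟩ := (((hom_with hα).trans (hom_slide σ a b)).trans (hom_with hβ.symm))
  have Hc : Continuous H := H.continuous
  have hu := CompactSpace.uniformContinuous_of_continuous Hc
  rw [Metric.uniformContinuous_iff] at hu
  obtain ⟨δ, hδ, hH⟩ := hu (r/4) (by linarith)
  obtain ⟨N, hN⟩ := exists_nat_one_div_lt hδ
  refine ⟨N + 1, Nat.succ_pos _, ?_⟩
  intro n hn
  have hn0 : 0 < n := by omega
  have hnr : (0:ℝ) < n := by exact_mod_cast hn0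
  let γ : ℕ → C(unitInterval, Z) := fun j => ⟨fun u => H (pt n j, u), by fun_prop⟩
  have hends : ∀ s : unitInterval, H (s, 0) = p ∧ ∃ t, H (s, 1) = c t := fun s => H.prop' s
  choose hp t ht using hends
  have pt0 : pt n 0 = 0 := by apply Subtype.ext; rw [pt_val (Nat.zero_le _)]; simp
  have H0 : ∀ u, H (0, u) = α u := fun u => H.map_zero_left u
  have H1 : ∀ u, H (1, u) = β u := fun u => H.map_one_left u
  let τ : ℕ → unitInterval := fun j => if j = 0 then a else if j = n then b else t (pt n j)
  have hτ : ∀ j, H (pt n j, 1) = c (τ j) := by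
    intro j
    show _ = c (if j = 0 then a else if j = n then b else t (pt n j))
    split_ifs with h1 h2
    · subst h1; rw [pt0, H0]; simp
    · subst h2; rw [pt_self hn0, H1]; simp
    · exact ht _
  let P : ∀ j, Path p (c (τ j)) := fun j => ⟨γ j, hp _, hτ j⟩
  have hPv : ∀ j u, P j u = H (pt n j, u) := fun j u => rfl
  have nb : ∀ j < n, ∀ u, dist (γ j u) (γ (j+1) u) < r / 4 := by
    intro j hj u
    apply hH
    rw [Prod.dist_eq]
    simp only [dist_self]
    rw [max_eq_left dist_nonneg]
    have h1 : dist (pt n j) (pt n (j+1)) = |(pt n j).1 - (pt n (j+1)).1| := rfl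
    rw [h1]
    refine (pt_step hj).trans_lt (lt_of_le_of_lt ?_ hN)
    apply one_div_le_one_div_of_le (by positivity)
    exact_mod_cast hn
  let E : ℕ → ℝ := fun j => Lm (γ j) (N+1) + K * |(τ j).1 - ((1 - (j:ℝ)/n) * a.1 + (j:ℝ)/n * b.1)|
  have hE : ∀ j, 0 ≤ E j := fun j => add_nonneg (Finset.sum_nonneg fun _ _ => dist_nonneg) (by positivity)
  refine ⟨∑ j ∈ Finset.range (n+1), E j, γ, τ, Finset.sum_nonneg fun j _ => hE j, ?_, nb, ?_, ?_⟩
  · intro j hj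
    refine ⟨P j, fun u => rfl, ?_⟩
    induction j with
    | zero =>
      have e : α = P 0 := by
        ext u
        rw [hPv, pt0, H0]
      rw [← e]; exact hα
    | succ j ih =>
      apply (ih (by omega)).close hZ hc
      intro u
      have := nb j (by omega) u
      have h2 : dist (P j u) (P (j+1) u) = dist (γ j u) (γ (j+1) u) := rfl
      linarith
  · intro j hj u w huw
    apply hH
    rw [Prod.dist_eq]
    simp only [dist_self]
    rw [max_eq_right dist_nonneg]
    refine lt_of_le_of_lt ?_ hN
    have h1 : dist u w = |u.1 - w.1| := rfl
    rw [h1]; exact_mod_cast huw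
  · intro j hj
    show E j ≤ _
    by_cases h0 : j = 0
    · subst h0
      have e1 : Lm (γ 0) (N+1) ≤ A := by
        have : γ 0 = α.toContinuousMap := by
          ext u; show H (pt n 0, u) = α u
          rw [pt0, H0]
        rw [this]
        exact Lm_le α _ hA lα
      have e2 : τ 0 = a := if_pos rfl
      simp only [E]
      rw [e2]; simpa using e1
    · by_cases h1 : j = n
      · subst h1
        have e1 : Lm (γ j) (N+1) ≤ B := by
          have : γ j = β.toContinuousMap := by
            ext u; show H (pt j j, u) = β u
            rw [pt_self hn0, H1]
          rw [this]
          exact Lm_le β _ hB lβ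
        have e2 : τ j = b := by
          show (if j = 0 then a else if j = j then b else t (pt j j)) = b
          rw [if_neg h0, if_pos rfl]
        simp only [E]
        rw [e2, div_self hnr.ne']
        simpa using e1
      · have hj1 : (1:ℝ) ≤ j := by exact_mod_cast (by omega : 1 ≤ j)
        have hj2 : (j:ℝ) + 1 ≤ n := by exact_mod_cast (by omega : j + 1 ≤ n)
        have h3 : E j ≤ ∑ j ∈ Finset.range (n+1), E j :=
          Finset.single_le_sum (f := E) (fun j _ => hE j) (Finset.mem_range.2 (by omega))
        have h4 : 1 ≤ (j:ℝ) * (n - j) := by nlinarith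
        have h5 : (j:ℝ)/n ≤ 1 := by rw [div_le_one hnr]; linarith
        have h6 : 0 ≤ (1 - (j:ℝ)/n) * A := mul_nonneg (by linarith) hA
        have h7 : 0 ≤ (j:ℝ)/n * B := by positivity
        have h8 : 0 ≤ ∑ j ∈ Finset.range (n+1), E j := (hE j).trans h3
        nlinarith

theorem abs_convex (hZ : LocCN Z r) (hr : 0 < r) (hc : ∀ s t, dist (c s) (c t) = K * |s.1 - t.1|)
    (hA : 0 ≤ A) (hB : 0 ≤ B) (α : Path p (c a)) (β : Path p (c b)) (hα : InP σ α) (hβ : InP σ β)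
    (lα : plen α ≤ ENNReal.ofReal A) (lβ : plen β ≤ ENNReal.ofReal B) (s : unitInterval)
    {ε : ℝ} (hε : 0 < ε) :
    ∃ P : Path p (c (segI a b s)), InP σ P ∧
      plen P ≤ ENNReal.ofReal ((1 - s.1) * A + s.1 * B + ε) := by
  have hK : 0 ≤ K := by
    have := hc 1 0
    simp at this
    rw [← this]; exact dist_nonneg
  obtain ⟨N, hN0, hN⟩ := rows_init hZ hr hc hA hB α β hα hβ lα lβ
  obtain ⟨M, hM⟩ := exists_nat_gt ((K + A + B) / (ε/2))
  set n := max N (M + 1) with hn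
  have hn0 : 0 < n := lt_of_lt_of_le hN0 (le_max_left _ _)
  have hnr : (0:ℝ) < n := by exact_mod_cast hn0
  have hMn : (M:ℝ) ≤ n := by exact_mod_cast (by omega : M ≤ n)
  have hnb : (K + A + B) / n ≤ ε/2 := by
    rw [div_le_iff₀ hnr]
    rw [div_lt_iff₀ (by linarith)] at hM
    nlinarith
  obtain ⟨Q, γ, τ, hQ, hG⟩ := hN n (le_max_left _ _)
  set j := ⌊s.1 * n⌋₊ with hj
  have hs0 := s.2.1
  have hs1 := s.2.2
  have hj1 : (j:ℝ) ≤ s.1 * n := Nat.floor_le (by positivity)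
  have hj2 : s.1 * n < j + 1 := Nat.lt_floor_add_one _
  have hjn : j ≤ n := by
    have : (j:ℝ) ≤ n := hj1.trans (by nlinarith)
    exact_mod_cast this
  obtain ⟨P, hP, hl⟩ := rows_final hZ hr hc hQ hn0 hN0 hG hjn (half_pos hε)
  refine ⟨P.trans (cP c _ _), hP.append _, ?_⟩
  refine (plen_trans _ _).trans ((add_le_add hl (plen_cP hc _ _)).trans ?_)
  have d1 : (j:ℝ)/n ≤ s.1 := by rw [div_le_iff₀ hnr]; exact hj1
  have d2 : s.1 - (j:ℝ)/n ≤ 1/n := by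
    have : s.1 ≤ (j+1)/n := by rw [le_div_iff₀ hnr]; exact hj2.le
    have e : ((j:ℝ)+1)/n = (j:ℝ)/n + 1/n := by ring
    linarith
  have d0 : 0 ≤ (j:ℝ)/n := by positivity
  rw [← ENNReal.ofReal_add]
  · apply ENNReal.ofReal_le_ofReal
    rw [segI_val, segI_val, pt_val hjn]
    have e : (1 - (j:ℝ)/n) * a.1 + (j:ℝ)/n * b.1 - ((1 - s.1) * a.1 + s.1 * b.1) =
      (s.1 - (j:ℝ)/n) * (a.1 - b.1) := by ring
    rw [e, abs_mul, abs_of_nonneg (by linarith)]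
    have hab : |a.1 - b.1| ≤ 1 := by
      rw [abs_le]; constructor <;> linarith [a.2.1, a.2.2, b.2.1, b.2.2]
    have h1 : (s.1 - (j:ℝ)/n) * |a.1 - b.1| ≤ 1/n := by
      calc _ ≤ (s.1 - (j:ℝ)/n) * 1 := mul_le_mul_of_nonneg_left hab (by linarith)
        _ ≤ 1/n := by linarith
    have h2 := mul_le_mul_of_nonneg_left h1 hK
    have h3 : (s.1 - (j:ℝ)/n) * A ≤ 1/n * A := mul_le_mul_of_nonneg_right d2 hA
    have h4 : 0 ≤ (s.1 - (j:ℝ)/n) * B := mul_nonneg (by linarith) hB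
    have h5 : 0 ≤ 1/(n:ℝ) * B := by positivity
    have e2 : (K + A + B) / n = K * (1/n) + 1/n * A + 1/n * B := by ring
    rw [e2] at hnb
    linarith
  · have : 0 ≤ (1 - (j:ℝ)/n) * A := mul_nonneg (by linarith) hA
    positivity
  · positivity
end

section
variable {X : Set E2}

def dE (x y : X) : ENNReal := ⨅ γ : Path x y, cost γ

lemma cost_trans {x y z : X} (γ : Path x y) (γ' : Path y z) : cost (γ.trans γ') ≤ cost γ + cost γ' :=
  evar_trans (fun z : X => (z : E2)) γ γ'

lemma cost_symm {x y : X} (γ : Path x y) : cost γ.symm ≤ cost γ := by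
  unfold cost
  have : (fun t => (γ.symm t : E2)) = (fun t => (γ t : E2)) ∘ unitInterval.symm := rfl
  rw [this]
  apply eVariationOn.comp_le_of_antitoneOn
  · intro a _ b _ hab
    exact unitInterval.symm_le_symm.2 hab
  · intro _ _; trivial

lemma dE_le {x y : X} (γ : Path x y) : dE x y ≤ cost γ := iInf_le _ γ

lemma dE_comm (x y : X) : dE x y = dE y x := by
  apply le_antisymm
  · exact le_iInf fun γ => (dE_le γ.symm).trans (cost_symm γ)
  · exact le_iInf fun γ => (dE_le γ.symm).trans (cost_symm γ)

lemma dE_self (x : X) : dE x x = 0 := by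
  apply le_antisymm _ zero_le
  refine (dE_le (Path.refl x)).trans (le_of_eq ?_)
  unfold cost
  apply eVariationOn.constant_on
  rintro _ ⟨a, -, rfl⟩ _ ⟨b, -, rfl⟩
  rfl

lemma dE_triangle (x y z : X) : dE x z ≤ dE x y + dE y z := by
  unfold dE
  rw [ENNReal.iInf_add]
  refine le_iInf fun γ => ?_
  rw [ENNReal.add_iInf]
  exact le_iInf fun γ' => (dE_le (γ.trans γ')).trans (cost_trans γ γ')

lemma edist_le_cost {x y : X} (γ : Path x y) : edist (x:E2) y ≤ cost γ := by
  have := eVariationOn.edist_le (fun t => (γ t : E2)) (s := Set.univ) (x := 0) (y := 1) trivial trivial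
  simp only [Path.source, Path.target] at this
  exact this

lemma edist_le_dE (x y : X) : edist (x:E2) y ≤ dE x y := le_iInf fun γ => edist_le_cost γ

lemma split_le_cost {x y : X} (γ : Path x y) (t : unitInterval) :
    edist (x:E2) (γ t) + edist (γ t : E2) y ≤ cost γ := by
  have hsplit := eVariationOn.Icc_add_Icc (fun t => (γ t : E2)) (s := Set.univ)
    (a := (0 : unitInterval)) (b := t) (c := 1) unitInterval.nonneg' unitInterval.le_one' (Set.mem_univ _)
  have h1 := eVariationOn.edist_le (fun t => (γ t : E2)) (s := Set.univ ∩ Set.Icc 0 t) (x := 0) (y := t) 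
    ⟨trivial, le_rfl, unitInterval.nonneg'⟩ ⟨trivial, unitInterval.nonneg', le_rfl⟩
  have h2 := eVariationOn.edist_le (fun t => (γ t : E2)) (s := Set.univ ∩ Set.Icc t 1) (x := t) (y := 1) 
    ⟨trivial, le_rfl, unitInterval.le_one'⟩ ⟨trivial, unitInterval.le_one', le_rfl⟩
  have h3 : eVariationOn (fun t => (γ t : E2)) (Set.univ ∩ Set.Icc 0 1) ≤ cost γ :=
    eVariationOn.mono _ (fun _ _ => trivial)
  simp only [Path.source, Path.target] at h1 h2
  refine le_trans ?_ h3
  rw [← hsplit]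
  exact add_le_add h1 h2

lemma cost_line {x₀ x₁ : E2} (h₀ : x₀ ∈ X) (h₁ : x₁ ∈ X) (hseg : segment ℝ x₀ x₁ ⊆ X) :
    cost (linePath h₀ h₁ hseg) ≤ ENNReal.ofReal ‖x₀ - x₁‖ := by
  refine plen_lip (linePath h₀ h₁ hseg) ?_
  intro s t
  show dist ((1 - s.1) • x₀ + s.1 • x₁) ((1 - t.1) • x₀ + t.1 • x₁) ≤ _
  rw [dist_eq_norm]
  have : (1 - s.1) • x₀ + s.1 • x₁ - ((1 - t.1) • x₀ + t.1 • x₁) = (t.1 - s.1) • (x₀ - x₁) := by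
    module
  rw [this, norm_smul, Real.norm_eq_abs, abs_sub_comm, mul_comm]

lemma dE_seg {x y : X} (h : Vis X x y) : dE x y ≤ ENNReal.ofReal ‖(x:E2) - y‖ := by
  have hseg : segment ℝ (x:E2) y ⊆ X := by
    rw [segment_eq_image]
    rintro _ ⟨t, ht, rfl⟩
    exact h t ht.1 ht.2
  exact (dE_le _).trans (cost_line x.2 y.2 hseg)

def shf (X : Set E2) (v : E2) : Set E2 := {u | v + u ∈ X}

lemma vis_shf {v x y : E2} (h : Vis (shf X v) (x - v) (y - v)) : Vis X x y := by
  intro t h0 h1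
  have := h t h0 h1
  have e : v + ((1 - t) • (x - v) + t • (y - v)) = (1 - t) • x + t • y := by module
  simp only [shf, Set.mem_ofPred_eq] at this
  rwa [e] at this

variable {v : X} {R : ℝ}

lemma mem_shf (v x : X) : (x:E2) - v ∈ shf X v := by
  simp [shf]

lemma dE_cone (hv : ConeLike (shf X v) R) {x : X} (hx : ‖(x:E2) - v‖ < R) :
    dE v x ≤ ENNReal.ofReal ‖(x:E2) - v‖ := by
  rw [norm_sub_rev]
  apply dE_seg
  apply vis_shf (v := v)
  rw [sub_self]
  exact vis_zero hv (mem_shf v x) hx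

lemma dE_le_dC (hv : ConeLike (shf X v) R) {x y : X} (hx : ‖(x:E2) - v‖ < R)
    (hy : ‖(y:E2) - v‖ < R) : dE x y ≤ ENNReal.ofReal (dC (shf X v) (x - v) (y - v)) := by
  by_cases h : Vis (shf X v) ((x:E2) - v) (y - v)
  · rw [dC_vis h, sub_sub_sub_cancel_right]
    exact dE_seg (vis_shf h)
  · rw [dC_nvis h, ENNReal.ofReal_add (norm_nonneg _) (norm_nonneg _)]
    refine (dE_triangle x v y).trans (add_le_add ?_ (dE_cone hv hy))
    rw [dE_comm]; exact dE_cone hv hx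

lemma cr_smul {m z : E2} (hm : m ≠ 0) (h : cr m z = 0) : ∃ k : ℝ, z = k • m := by
  have hpos : 0 < m 0 ^ 2 + m 1 ^ 2 := by
    by_contra hc
    apply hm
    ext i
    have a0 : m 0 = 0 := by nlinarith [sq_nonneg (m 0), sq_nonneg (m 1)]
    have a1 : m 1 = 0 := by nlinarith [sq_nonneg (m 0), sq_nonneg (m 1)]
    fin_cases i <;> simp [a0, a1]
  refine ⟨(m 0 * z 0 + m 1 * z 1) / (m 0 ^ 2 + m 1 ^ 2), ?_⟩
  unfold cr at h
  ext i
  fin_cases i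
  · simp
    rw [div_mul_eq_mul_div, eq_div_iff hpos.ne']
    linear_combination (- m 1) * h
  · simp
    rw [div_mul_eq_mul_div, eq_div_iff hpos.ne']
    linear_combination (m 0) * h

lemma dC_le_cost (hv : ConeLike (shf X v) R) {x y : X} (hx : ‖(x:E2) - v‖ < R / 2)
    (hy : ‖(y:E2) - v‖ < R / 2) (γ : Path x y) :
    ENNReal.ofReal (dC (shf X v) (x - v) (y - v)) ≤ cost γ := by
  have hR : 0 < R := by linarith [norm_nonneg ((x:E2) - v)]
  by_cases h : Vis (shf X v) ((x:E2) - v) (y - v)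
  · rw [dC_vis h, sub_sub_sub_cancel_right, ← dist_eq_norm, ← edist_dist]
    exact edist_le_cost γ
  rw [dC_nvis h]
  suffices hs : ∃ t, ‖(x:E2) - v‖ + ‖(y:E2) - v‖ ≤ dist (x:E2) (γ t) + dist (γ t : E2) y by
    obtain ⟨t, ht⟩ := hs
    refine (ENNReal.ofReal_le_ofReal ht).trans ?_
    rw [ENNReal.ofReal_add dist_nonneg dist_nonneg, ← edist_dist, ← edist_dist]
    exact split_le_cost γ t
  by_cases hfar : ∃ t, R ≤ ‖(γ t : E2) - v‖
  · obtain ⟨t, ht⟩ := hfar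
    refine ⟨t, ?_⟩
    have e1 : ‖(γ t : E2) - v‖ ≤ dist (x:E2) (γ t) + ‖(x:E2) - v‖ := by
      rw [dist_comm, dist_eq_norm]
      have := norm_add_le ((γ t : E2) - x) (x - v)
      simpa using this
    have e2 : ‖(γ t : E2) - v‖ ≤ dist (γ t : E2) y + ‖(y:E2) - v‖ := by
      rw [dist_eq_norm]
      have := norm_add_le ((γ t : E2) - y) (y - v)
      simpa using this
    linarith
  push Not at hfar
  obtain ⟨s, s0, s1, hs⟩ := nvis_exists (mem_shf v x) (mem_shf v y) h
  set m : E2 := (1 - s) • ((x:E2) - v) + s • ((y:E2) - v) with hm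
  have hm0 : m ≠ 0 := by
    intro h0; rw [h0] at hs; exact hs hv.1
  have hcont : Continuous (fun t => cr m ((γ t : E2) - v)) := by
    unfold cr; fun_prop
  have hc0 : cr m ((γ 0 : E2) - v) = s * cr ((y:E2) - v) (x - v) := by
    simp only [Path.source, hm, cr]; simp; ring
  have hc1 : cr m ((γ 1 : E2) - v) = - ((1 - s) * cr ((y:E2) - v) (x - v)) := by
    simp only [Path.target, hm, cr]; simp; ring
  obtain ⟨t, ht⟩ : ∃ t, cr m ((γ t : E2) - v) = 0 := by
    rcases le_total 0 (cr ((y:E2) - v) (x - v)) with hp | hp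
    · exact mem_range_of_exists_le_of_exists_ge hcont
        ⟨1, by rw [hc1]; have := mul_nonneg (by linarith : 0 ≤ 1 - s) hp; linarith⟩
        ⟨0, by rw [hc0]; positivity⟩
    · exact mem_range_of_exists_le_of_exists_ge hcont
        ⟨0, by rw [hc0]; exact mul_nonpos_of_nonneg_of_nonpos s0.le hp⟩
        ⟨1, by rw [hc1]; have := mul_nonpos_of_nonneg_of_nonpos (by linarith : 0 ≤ 1 - s) hp; linarith⟩
  obtain ⟨k, hk⟩ := cr_smul hm0 ht
  refine ⟨t, ?_⟩
  have hmR : ‖m‖ < R := norm_comb_lt (by linarith) (by linarith) s0.le s1.le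
  have hk0 : k ≤ 0 := by
    by_contra hk0
    push Not at hk0
    apply hs
    have h1 : m = k⁻¹ • ((γ t : E2) - v) := by
      rw [hk, smul_smul, inv_mul_cancel₀ hk0.ne', one_smul]
    rw [h1]
    apply hv.2 _ (mem_shf v (γ t)) (hfar t) _ (by positivity)
    rw [← h1]; exact hmR
  have := norm_triangle_in (x := (x:E2) - v) (y := (y:E2) - v) (z := (γ t : E2) - v)
    (α := (-k) * (1 - s)) (β := (-k) * s) (mul_nonneg (by linarith) (by linarith))
    (mul_nonneg (by linarith) s0.le) (by rw [hk, hm]; module)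
  rw [sub_sub_sub_cancel_right, sub_sub_sub_cancel_right, ← dist_eq_norm, ← dist_eq_norm] at this
  rwa [dist_comm (γ t : E2) y]

lemma dE_eq_dC (hv : ConeLike (shf X v) R) {x y : X} (hx : ‖(x:E2) - v‖ < R / 2)
    (hy : ‖(y:E2) - v‖ < R / 2) :
    dE x y = ENNReal.ofReal (dC (shf X v) (x - v) (y - v)) := by
  have hR : 0 < R := by linarith [norm_nonneg ((x:E2) - v)]
  exact le_antisymm (dE_le_dC hv (by linarith) (by linarith)) (le_iInf fun γ => dC_le_cost hv hx hy γ)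

def HasCharts (X : Set E2) : Prop := ∀ v ∈ X, ∃ R > 0, ConeLike (shf X v) R

lemma dE_ne_top (hC : HasCharts X) (hpc : IsPathConnected X) (x y : X) : dE x y ≠ ⊤ := by
  have : PathConnectedSpace X := isPathConnected_iff_pathConnectedSpace.1 hpc
  have hloc : ∀ y : X, ∀ᶠ z in nhds y, dE y z ≠ ⊤ := by
    intro y
    obtain ⟨R, hR, hv⟩ := hC y y.2
    have : Metric.ball y R ∈ nhds y := Metric.ball_mem_nhds y hR
    filter_upwards [this] with z hz
    have hz' : ‖(z:E2) - y‖ < R := by rw [← dist_eq_norm]; exact hz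
    exact ((dE_cone hv hz').trans_lt ENNReal.ofReal_lt_top).ne
  have hcl : IsClopen {z | dE x z ≠ ⊤} := by
    constructor
    · rw [← isOpen_compl_iff, isOpen_iff_mem_nhds]
      intro y hy
      filter_upwards [hloc y] with z hz hz'
      apply hy
      have := dE_triangle x z y
      rw [dE_comm z y] at this
      exact (this.trans_lt (ENNReal.add_lt_top.2 ⟨lt_top_iff_ne_top.2 hz', lt_top_iff_ne_top.2 hz⟩)).ne
    · rw [isOpen_iff_mem_nhds]
      intro y hy
      filter_upwards [hloc y] with z hz
      have := dE_triangle x y z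
      exact (this.trans_lt (ENNReal.add_lt_top.2 ⟨lt_top_iff_ne_top.2 hy, lt_top_iff_ne_top.2 hz⟩)).ne
  have := hcl.eq_univ ⟨x, by simp [dE_self]⟩
  have hy : y ∈ {z | dE x z ≠ ⊤} := by rw [this]; trivial
  exact hy

def dI (x y : X) : ℝ := (dE x y).toReal

lemma norm_le_dI (hC : HasCharts X) (hpc : IsPathConnected X) (x y : X) : ‖(x:E2) - y‖ ≤ dI x y := by
  have := ENNReal.toReal_mono (dE_ne_top hC hpc x y) (edist_le_dE x y)
  rwa [edist_dist, ENNReal.toReal_ofReal dist_nonneg, dist_eq_norm] at this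

lemma dI_eq_dC (hv : ConeLike (shf X v) R) {x y : X} (hx : ‖(x:E2) - v‖ < R / 2)
    (hy : ‖(y:E2) - v‖ < R / 2) : dI x y = dC (shf X v) (x - v) (y - v) := by
  unfold dI
  rw [dE_eq_dC hv hx hy, ENNReal.toReal_ofReal (dC_nonneg _ _ _)]

@[reducible] def metI (hC : HasCharts X) (hpc : IsPathConnected X) : MetricSpace X :=
  MetricSpace.ofDistTopology dI (fun x => by simp [dI, dE_self]) (fun x y => by simp [dI, dE_comm x y])
    (fun x y z => by
      unfold dI
      rw [← ENNReal.toReal_add (dE_ne_top hC hpc _ _) (dE_ne_top hC hpc _ _)]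
      exact ENNReal.toReal_mono (ENNReal.add_ne_top.2 ⟨dE_ne_top hC hpc _ _, dE_ne_top hC hpc _ _⟩) (dE_triangle _ _ _))
    (fun s => by
      rw [Metric.isOpen_iff]
      constructor
      · intro h x hx
        obtain ⟨ε, hε, hb⟩ := h x hx
        refine ⟨ε, hε, fun y hy => hb ?_⟩
        rw [Metric.mem_ball, dist_comm]
        show dist (x:E2) y < ε
        rw [dist_eq_norm]
        exact (norm_le_dI hC hpc x y).trans_lt hy
      · intro h x hx
        obtain ⟨ε, hε, hb⟩ := h x hx
        obtain ⟨R, hR, hv⟩ := hC x x.2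
        refine ⟨min ε R, lt_min hε hR, fun y hy => hb y ?_⟩
        have hy' : ‖(y:E2) - x‖ < min ε R := by rw [← dist_eq_norm]; exact hy
        have := ENNReal.toReal_mono ENNReal.ofReal_ne_top (dE_cone hv (hy'.trans_le (min_le_right _ _)))
        rw [ENNReal.toReal_ofReal (norm_nonneg _)] at this
        exact this.trans_lt (hy'.trans_le (min_le_left _ _)))
    (fun x y h => by
      have := norm_le_dI hC hpc x y
      rw [h] at this
      have := norm_le_zero_iff.1 this
      exact Subtype.ext (sub_eq_zero.1 this))

lemma metI_dist (hC : HasCharts X) (hpc : IsPathConnected X) (x y : X) :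
    (metI hC hpc).dist x y = dI x y := rfl

lemma metI_edist (hC : HasCharts X) (hpc : IsPathConnected X) (x y : X) :
    (metI hC hpc).edist x y = dE x y := by
  have : (metI hC hpc).edist x y = ENNReal.ofReal ((metI hC hpc).dist x y) := 
    @edist_dist X (metI hC hpc).toPseudoMetricSpace x y
  rw [this, metI_dist]
  exact ENNReal.ofReal_toReal (dE_ne_top hC hpc x y)

lemma metI_top (hC : HasCharts X) (hpc : IsPathConnected X) :
    (metI hC hpc).toUniformSpace.toTopologicalSpace = instTopologicalSpaceSubtype := rfl

lemma plen_cost (hC : HasCharts X) (hpc : IsPathConnected X) {x y : X} (γ : Path x y) :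
    @plen X (metI hC hpc) x y γ = cost γ := by
  apply le_antisymm
  · unfold plen
    apply iSup_le
    rintro ⟨n, u, hu, -⟩
    have h1 : ∀ i, (metI hC hpc).edist (γ (u (i+1))) (γ (u i)) ≤
        eVariationOn (fun t => (γ t : E2)) (Set.Icc (u i) (u (i+1))) := by
      intro i
      rw [metI_edist, dE_comm]
      refine (dE_le (subpath γ (u i) (u (i+1)))).trans ?_
      unfold cost
      have e : (fun t => ((subpath γ (u i) (u (i+1))) t : E2)) = (fun t => (γ t : E2)) ∘ (segI (u i) (u (i+1))) := rfl
      rw [e]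
      have hle : (u i).1 ≤ (u (i+1)).1 := hu (Nat.le_succ i)
      apply eVariationOn.comp_le_of_monotoneOn
      · intro s _ t _ hst
        have : s.1 ≤ t.1 := hst
        show (segI _ _ s).1 ≤ (segI _ _ t).1
        rw [segI_val, segI_val]
        nlinarith
      · intro s _
        have := s.2.1
        have := s.2.2
        constructor
        · show _ ≤ (segI _ _ s).1
          rw [segI_val]; nlinarith
        · show (segI _ _ s).1 ≤ _
          rw [segI_val]; nlinarith
    refine (Finset.sum_le_sum fun i _ => h1 i).trans ?_
    rw [eVariationOn.sum' _ hu]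
    exact eVariationOn.mono _ (fun _ _ => trivial)
  · unfold cost
    apply iSup_le
    rintro ⟨n, u, hu, hus⟩
    refine le_trans ?_ (@eVariationOn.sum_le _ _ X (metI hC hpc).toPseudoEMetricSpace γ Set.univ n u hu hus)
    apply Finset.sum_le_sum
    intro i _
    refine (edist_le_dE _ _).trans (le_of_eq ?_)
    exact (metI_edist hC hpc _ _).symm

lemma locCN_gen {Y : Type*} [MetricSpace Y] [CompactSpace Y] (e : Y → E2) (he : Continuous e)
    (hX : ∀ z, z ∈ X ↔ ∃ y, e y = z) (R : Y → ℝ) (hR : ∀ v, 0 < R v)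
    (hcone : ∀ v, ConeLike (shf X (e v)) (R v))
    (hd : ∀ v x y, ‖e x - e v‖ < R v / 2 → ‖e y - e v‖ < R v / 2 →
      dist x y = dC (shf X (e v)) (e x - e v) (e y - e v)) : ∃ r > 0, LocCN Y r := by
  have hopen : ∀ v : Y, IsOpen {x : Y | ‖e x - e v‖ < R v / 2} := by
    intro v
    apply isOpen_lt (by fun_prop) continuous_const
  obtain ⟨r, hr, hball⟩ := lebesgue_number_lemma_of_metric (isCompact_univ (X := Y)) hopen
    (fun x _ => Set.mem_iUnion.2 ⟨x, by simp; exact hR x⟩)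
  have hmem : ∀ v x : Y, e x - e v ∈ shf X (e v) := by
    intro v x
    show e v + (e x - e v) ∈ X
    rw [hX]; exact ⟨x, by abel⟩
  refine ⟨r, hr, ?_⟩
  intro a b hab s h0 h1
  obtain ⟨v, hv⟩ := hball a trivial
  have inb : ∀ x : Y, dist a x < r → ‖e x - e v‖ < R v / 2 := by
    intro x hx
    apply hv
    rw [Metric.mem_ball, dist_comm]; exact hx
  have ha := inb a (by simpa using hr)
  have hb := inb b hab
  have hRv := hR v
  obtain ⟨g, hg, hgR, g1, g2, g3⟩ := cone_cn (hcone v) (hmem v a) (hmem v b)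
    (R' := R v / 2) (by linarith) ha hb h0 h1
  obtain ⟨g', hg0⟩ := (hX (e v + g)).1 hg
  have hg' : e g' - e v = g := by rw [hg0]; abel
  have hgb : ‖e g' - e v‖ < R v / 2 := by rw [hg']; exact hgR
  refine ⟨g', ?_, ?_, ?_⟩
  · rw [hd v _ _ ha hgb, hd v _ _ ha hb, hg']; exact g1
  · rw [hd v _ _ hgb hb, hd v _ _ ha hb, hg']; exact g2
  · intro x hx
    have hxb := inb x hx
    rw [hd v _ _ hxb hgb, hd v _ _ ha hb, hd v _ _ hxb ha, hd v _ _ hxb hb, hg']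
    exact g3 _ (hmem v x) hxb

lemma metI_locCN (hC : HasCharts X) (hpc : IsPathConnected X) (hcomp : IsCompact X) :
    ∃ r > 0, @LocCN X (metI hC hpc) r := by
  have hC' := hC
  choose R hR hcone using hC'
  have hcs : CompactSpace X := isCompact_iff_compactSpace.1 hcomp
  exact @locCN_gen X X (metI hC hpc) hcs (fun x => (x:E2)) continuous_subtype_val
    (fun z => by simp) (fun v => R v v.2) (fun v => hR v v.2) (fun v => hcone v v.2)
    (fun v x y hx hy => dI_eq_dC (hcone v v.2) hx hy)
end

section
open Filter Topology

def Ray (C : Set E2) (v : E2) (R : ℝ) : Prop :=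
  ∀ u, v + u ∈ C → ‖u‖ < R → ∀ k : ℝ, 0 ≤ k → ‖k • u‖ < R → v + k • u ∈ C

lemma ray_simplex (t : Finset E2) (ht : AffineIndependent ℝ ((↑) : t → E2)) (v : E2) :
    ∀ᶠ R in 𝓝[>] (0:ℝ), Ray (convexHull ℝ (t : Set E2)) v R := by
  by_cases hv : v ∈ convexHull ℝ (t : Set E2)
  · obtain ⟨l, l0, l1, lv⟩ := Finset.mem_convexHull'.1 hv
    let L : (t → ℝ) →ₗ[ℝ] E2 × ℝ :=
      { toFun := fun w => (∑ j, w j • (j:E2), ∑ j, w j)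
        map_add' := by
          intro x y; ext1 <;> simp [add_smul, Finset.sum_add_distrib]
        map_smul' := by
          intro k x; ext1 <;> simp [mul_smul, Finset.smul_sum, Finset.mul_sum] }
    have hker : LinearMap.ker L = ⊥ := by
      rw [LinearMap.ker_eq_bot']
      intro w hw
      have h1 : ∑ j, w j • (j:E2) = 0 := congrArg Prod.fst hw
      have h2 : ∑ j, w j = 0 := congrArg Prod.snd hw
      ext j
      exact affineIndependent_iff.1 ht Finset.univ w h2 h1 j (Finset.mem_univ j)
    obtain ⟨K, hK, hL⟩ := L.exists_antilipschitzWith hker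
    have hbound : ∀ w : E2 → ℝ, ∑ j ∈ t, w j = 0 → ∀ j ∈ t, |w j| ≤ K * ‖∑ j ∈ t, w j • j‖ := by
      intro w hw j hj
      have h := hL.le_mul_dist (fun j : t => w j) 0
      rw [map_zero, dist_zero_right, dist_zero_right] at h
      have e1 : L (fun j : t => w j) = (∑ j ∈ t, w j • j, 0) := by
        show (∑ j : t, w j • (j:E2), ∑ j : t, w j) = _
        rw [Finset.sum_coe_sort t (fun j => w j • j), Finset.sum_coe_sort t (fun j => w j), hw]
      rw [e1] at h
      have e2 : ‖(∑ j ∈ t, w j • j, (0:ℝ))‖ = ‖∑ j ∈ t, w j • j‖ := by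
        rw [Prod.norm_def]; simp
      rw [e2] at h
      have h3 := norm_le_pi_norm (fun j : t => w j) ⟨j, hj⟩
      exact h3.trans h
    have hev : ∀ᶠ R in 𝓝[>] (0:ℝ), ∀ j ∈ t, 0 < l j → K * R < l j := by
      rw [eventually_all_finset]
      intro j hj
      by_cases hlj : 0 < l j
      · have hcont : Tendsto (fun R : ℝ => (K:ℝ) * R) (𝓝[>] 0) (𝓝 (K * 0)) :=
          (Continuous.tendsto (by fun_prop) 0).mono_left nhdsWithin_le_nhds
        have := hcont.eventually_lt_const (u := l j) (by simpa using hlj)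
        filter_upwards [this] with R hR _ using hR
      · exact Eventually.of_forall fun R h => absurd h hlj
    filter_upwards [hev] with R hR
    intro u hu huR k hk hkR
    obtain ⟨m, m0, m1, mv⟩ := Finset.mem_convexHull'.1 hu
    have hdiff : ∑ j ∈ t, (m j - l j) • j = u := by
      simp only [sub_smul, Finset.sum_sub_distrib]
      rw [mv, lv]; abel
    have hsum0 : ∑ j ∈ t, (m j - l j) = 0 := by rw [Finset.sum_sub_distrib, m1, l1, sub_self]
    rw [Finset.mem_convexHull']
    refine ⟨fun j => l j + k * (m j - l j), ?_, ?_, ?_⟩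
    · intro j hj
      have hl := l0 j hj
      have hm := m0 j hj
      rcases hl.lt_or_eq with hpos | hz
      · have h1 := hR j hj hpos
        have h2 := hbound (fun j => k * (m j - l j)) (by rw [← Finset.mul_sum, hsum0, mul_zero]) j hj
        have h3 : ∑ j ∈ t, (k * (m j - l j)) • j = k • u := by
          rw [← hdiff, Finset.smul_sum]; simp only [mul_smul]
        simp only [h3] at h2
        have h4 : (K:ℝ) * ‖k • u‖ ≤ K * R := mul_le_mul_of_nonneg_left hkR.le K.2
        have h5 := neg_abs_le (k * (m j - l j))
        show 0 ≤ l j + k * (m j - l j)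
        linarith
      · show 0 ≤ l j + k * (m j - l j)
        rw [← hz]
        have := mul_nonneg hk hm
        linarith
    · rw [Finset.sum_add_distrib, ← Finset.mul_sum, hsum0, l1]; simp
    · simp only [add_smul, Finset.sum_add_distrib, mul_smul]
      rw [lv, ← Finset.smul_sum, hdiff]
  · have hcl : IsClosed (convexHull ℝ (t : Set E2)) := t.finite_toSet.isClosed_convexHull ℝ
    have hmem : (convexHull ℝ (t : Set E2))ᶜ ∈ 𝓝 v := hcl.isOpen_compl.mem_nhds hv
    obtain ⟨R0, hR0, hb⟩ := Metric.mem_nhds_iff.1 hmem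
    filter_upwards [Ioo_mem_nhdsGT hR0] with R hR
    intro u hu huR
    exfalso
    refine hb ?_ hu
    rw [Metric.mem_ball, dist_eq_norm]
    simpa using huR.trans hR.2

lemma hasCharts {X : Set E2}
    (hpoly : ∃ (n : ℕ) (P : Fin n → Finset E2), X = ⋃ i, convexHull ℝ (↑(P i) : Set E2)) :
    HasCharts X := by
  obtain ⟨n, P, rfl⟩ := hpoly
  intro v hv
  have hfin : ∀ᶠ R in 𝓝[>] (0:ℝ), ∀ i, ∀ t ∈ (P i).powerset,
      AffineIndependent ℝ ((↑) : t → E2) → Ray (convexHull ℝ (t : Set E2)) v R := by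
    rw [eventually_all]
    intro i
    rw [eventually_all_finset]
    intro t _
    by_cases ht : AffineIndependent ℝ ((↑) : t → E2)
    · filter_upwards [ray_simplex t ht v] with R hR _ using hR
    · exact Eventually.of_forall fun R h => absurd h ht
  obtain ⟨R, hR, hR0⟩ := (hfin.and self_mem_nhdsWithin).exists
  refine ⟨R, hR0, ?_, ?_⟩
  · show v + 0 ∈ ⋃ i, convexHull ℝ (↑(P i) : Set E2)
    rwa [add_zero]
  · intro x hx hxR k hk hkR
    have hx' : v + x ∈ ⋃ i, convexHull ℝ (↑(P i) : Set E2) := hx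
    show v + k • x ∈ ⋃ i, convexHull ℝ (↑(P i) : Set E2)
    rw [Set.mem_iUnion] at hx' ⊢
    obtain ⟨i, hi⟩ := hx'
    refine ⟨i, ?_⟩
    rw [convexHull_eq_union] at hi
    simp only [Set.mem_iUnion] at hi
    obtain ⟨t, hts, hta, htx⟩ := hi
    have := hR i t (Finset.mem_powerset.2 (by exact_mod_cast hts)) hta x htx hxR k hk hkR
    exact convexHull_mono hts this

end

lemma bridge {X : Set E2} (hC : HasCharts X) (hpc : IsPathConnected X) (hcomp : IsCompact X)
    {p : X} {c : C(unitInterval, X)} {K : ℝ} (hc : ∀ s t, dI (c s) (c t) = K * |s.1 - t.1|)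
    (σ : Path p (c 0)) {A B : ℝ} (hA : 0 ≤ A) (hB : 0 ≤ B) {a b : unitInterval}
    (α : Path p (c a)) (β : Path p (c b))
    (hα : α.Homotopic (σ.trans (cP c 0 a))) (hβ : β.Homotopic (σ.trans (cP c 0 b)))
    (lα : cost α ≤ ENNReal.ofReal A) (lβ : cost β ≤ ENNReal.ofReal B) (s : unitInterval)
    {ε : ℝ} (hε : 0 < ε) :
    ∃ P : Path p (c (segI a b s)), P.Homotopic (σ.trans (cP c 0 (segI a b s))) ∧
      cost P ≤ ENNReal.ofReal ((1 - s.1) * A + s.1 * B + ε) := by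
  obtain ⟨r, hr, hZ⟩ := metI_locCN hC hpc hcomp
  obtain ⟨P, hP, hl⟩ := @abs_convex X (metI hC hpc) r K A B p c σ a b hZ hr hc hA hB α β hα hβ
    (by rw [plen_cost]; exact lα) (by rw [plen_cost]; exact lβ) s ε hε
  rw [plen_cost] at hl
  exact ⟨P, hP, hl⟩

/-- if the free space is compact, path-connected and a finite union of
convex polygons, the function `f(t) = m[σ * l_{[0,t]}]` is convex on `[0,1]`. -/
theorem mcost_line_convexOn {X : Set E2} (hcomp : IsCompact X) (hpc : IsPathConnected X)
    (hpoly : ∃ (n : ℕ) (P : Fin n → Finset E2), X = ⋃ i, convexHull ℝ (↑(P i) : Set E2))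
    {xa : X} {x₀ x₁ : E2} (h₀ : x₀ ∈ X) (h₁ : x₁ ∈ X) (hseg : segment ℝ x₀ x₁ ⊆ X)
    (σ : Path xa (⟨x₀, h₀⟩ : X)) (hfin : cost σ ≠ ⊤)
    (f : ℝ → ℝ)
    (hf : ∀ t : unitInterval,
      f t.1 = (mCost (σ.trans (subpath0 (linePath h₀ h₁ hseg) t))).toReal) :
    ConvexOn ℝ (Set.Icc (0:ℝ) 1) f := by
  have hC := hasCharts hpoly
  set l := linePath h₀ h₁ hseg with hl
  let c : C(unitInterval, X) := l.toContinuousMap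
  let σ' : Path xa (c 0) := σ.cast rfl l.source
  have hcv : ∀ t, ((c t : X) : E2) = (1 - t.1) • x₀ + t.1 • x₁ := fun t => rfl
  have heq : ∀ t, σ.trans (subpath0 l t) = σ'.trans (cP c 0 t) := fun t => rfl
  have hnorm : ∀ s t, ‖((c s : X) : E2) - c t‖ = ‖x₀ - x₁‖ * |s.1 - t.1| := by
    intro s t
    rw [hcv, hcv]
    have : (1 - s.1) • x₀ + s.1 • x₁ - ((1 - t.1) • x₀ + t.1 • x₁) = (t.1 - s.1) • (x₀ - x₁) := by
      module
    rw [this, norm_smul, Real.norm_eq_abs, abs_sub_comm, mul_comm]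
  have hc : ∀ s t, dI (c s) (c t) = ‖x₀ - x₁‖ * |s.1 - t.1| := by
    intro s t
    rw [← hnorm]
    apply le_antisymm _ (norm_le_dI hC hpc _ _)
    have hv : Vis X (c s) (c t) := by
      intro u u0 u1
      rw [hcv, hcv]
      have e : (1 - u) • ((1 - s.1) • x₀ + s.1 • x₁) + u • ((1 - t.1) • x₀ + t.1 • x₁) =
        (c (segI s t ⟨u, u0, u1⟩) : X) := by
        rw [hcv, segI_val]; module
      rw [e]; exact (c _).2
    have := ENNReal.toReal_mono ENNReal.ofReal_ne_top (dE_seg hv)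
    rwa [ENNReal.toReal_ofReal (norm_nonneg _)] at this
  have hft : ∀ t, mCost (σ.trans (subpath0 l t)) ≠ ⊤ := by
    intro t
    have h1 : mCost (σ.trans (subpath0 l t)) ≤ cost (σ.trans (subpath0 l t)) :=
      iInf_le (fun σ'' : {σ'' : Path xa (l t) // (σ.trans (subpath0 l t)).Homotopic σ''} => cost σ''.1)
        ⟨_, Path.Homotopic.refl _⟩
    have h2 : cost (subpath0 l t) ≤ ENNReal.ofReal (‖x₀ - x₁‖ * |(0:unitInterval).1 - t.1|) := by
      apply plen_cP (c := c) (K := ‖x₀ - x₁‖)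
      intro s t
      rw [← hnorm]
      exact dist_eq_norm ((c s : X) : E2) (c t)
    refine ((h1.trans (cost_trans _ _)).trans_lt (ENNReal.add_lt_top.2 ⟨hfin.lt_top, ?_⟩)).ne
    exact h2.trans_lt ENNReal.ofReal_lt_top
  have hex : ∀ (t : unitInterval) (ε : ℝ), 0 < ε → ∃ α : Path xa (c t),
      α.Homotopic (σ'.trans (cP c 0 t)) ∧ cost α ≤ ENNReal.ofReal (f t.1 + ε) := by
    intro t ε hε
    have hlt : mCost (σ.trans (subpath0 l t)) < ENNReal.ofReal (f t.1 + ε) := by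
      rw [← ENNReal.ofReal_toReal (hft t), ← hf]
      apply (ENNReal.ofReal_lt_ofReal_iff _).2 (by linarith)
      have : 0 ≤ f t.1 := by rw [hf]; exact ENNReal.toReal_nonneg
      linarith
    obtain ⟨⟨α, hα⟩, h⟩ := iInf_lt_iff.1 hlt
    exact ⟨α, hα.symm, h.le⟩
  have fnn : ∀ t : unitInterval, 0 ≤ f t.1 := fun t => by rw [hf]; exact ENNReal.toReal_nonneg
  refine ⟨convex_Icc 0 1, ?_⟩
  intro x hx y hy p q hp hq hpq
  let a : unitInterval := ⟨x, hx⟩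
  let b : unitInterval := ⟨y, hy⟩
  let s : unitInterval := ⟨q, hq, by linarith⟩
  have hpt : p • x + q • y = (segI a b s).1 := by
    rw [segI_val]
    have : p = 1 - q := by linarith
    subst this; rfl
  rw [hpt]
  apply le_of_forall_pos_le_add
  intro ε hε
  obtain ⟨α, hα, lα⟩ := hex a (ε/2) (by linarith)
  obtain ⟨β, hβ, lβ⟩ := hex b (ε/2) (by linarith)
  obtain ⟨P, hP, lP⟩ := bridge hC hpc hcomp hc σ' (by linarith [fnn a]) (by linarith [fnn b])
    α β hα hβ lα lβ s (half_pos hε)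
  have h1 : mCost (σ.trans (subpath0 l (segI a b s))) ≤ cost P :=
    iInf_le (fun σ'' : {σ'' : Path xa (l (segI a b s)) //
      (σ.trans (subpath0 l (segI a b s))).Homotopic σ''} => cost σ''.1) ⟨P, hP.symm⟩
  have h2 := ENNReal.toReal_mono ENNReal.ofReal_ne_top (h1.trans lP)
  have e0 : f (segI a b s).1 = (mCost (σ.trans (subpath0 l (segI a b s)))).toReal := hf _
  rw [← e0, ENNReal.toReal_ofReal] at h2
  · refine h2.trans (le_of_eq ?_)
    have : p = 1 - q := by linarith
    subst this
    simp only [smul_eq_mul]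
    show (1 - q) * (f x + ε/2) + q * (f y + ε/2) + ε/2 = _
    ring
  · have ha := fnn a
    have hb := fnn b
    have := s.2.1
    have : 0 ≤ 1 - s.1 := by linarith [s.2.2]
    positivity

end THPP
end
end
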